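/- If a finite simple graph G with nonempty edge set has a perfect ordered matching, then sdst(J(G)) = (ℓ(G)+1)/2, i.e., 2·sdst(J(G)) = ℓ(G) + 1. -/

import Mathlib

open SimpleGraph

namespace DS

variable {V : Type*}

/-- The set of edges of a matching presented by the endpoint functions `u`, `v`. -/
def omEdges {s : ℕ} (u v : Fin s → V) : Set (Sym2 V) := {e | ∃ i, e = s(u i, v i)}

/-- `(u, v)` describes a matching of size `s` in `G`: the `2s` endpoints are pairwise
distinct (so the edges are pairwise disjoint) and each pair `{u i, v i}` is an edge. -/
def IsMatchingPair (G : SimpleGraph V) {s : ℕ} (u v : Fin s → V) : Prop :=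
  Function.Injective (Sum.elim u v) ∧ ∀ i, G.Adj (u i) (v i)

/-- `(u, v)` describes an ordered matching: a matching such that `{u 1, …, u s}` is an
independent set and `{u i, v j} ∈ E(G)` implies `i ≤ j`. -/
def IsOrderedMatching (G : SimpleGraph V) {s : ℕ} (u v : Fin s → V) : Prop :=
  IsMatchingPair G u v ∧ (∀ i j, ¬ G.Adj (u i) (u j)) ∧
    ∀ i j, G.Adj (u i) (v j) → i ≤ j

/-- The matching number of `G`. -/
noncomputable def nu (G : SimpleGraph V) : ℕ :=
  sSup {s | ∃ u v : Fin s → V, IsMatchingPair G u v}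

/-- The ordered matching number of `G`. -/
noncomputable def nu0 (G : SimpleGraph V) : ℕ :=
  sSup {s | ∃ u v : Fin s → V, IsOrderedMatching G u v}

/-- A walk is `M`-alternating if its edges are alternately in `M` and not in `M`. -/
def IsAlt {G : SimpleGraph V} (M : Set (Sym2 V)) {a b : V} (w : G.Walk a b) : Prop :=
  List.Chain' (fun e f => (e ∈ M ↔ f ∉ M)) w.edges

/-- The walk `w` is nonempty and its first and last edges belong to `M`. -/
def FirstLastInM {G : SimpleGraph V} (M : Set (Sym2 V)) {a b : V} (w : G.Walk a b) : Prop :=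
  ∃ h : w.edges ≠ [], w.edges.head h ∈ M ∧ w.edges.getLast h ∈ M

/-- `w` is an `M`-admissible path for the vertex `x` (with respect to the ordered matching
presented by `(u, v)`): an `M`-alternating path with origin `x` whose first and last
edges are in `M`, each of whose edges has an end in `A = range u` and an end in
`B = range v`. -/
def IsAdmissible {G : SimpleGraph V} {s : ℕ} (u v : Fin s → V) {a b : V}
    (w : G.Walk a b) (x : V) : Prop :=
  a = x ∧ IsAlt (omEdges u v) w ∧ FirstLastInM (omEdges u v) w ∧
    ∀ e ∈ w.edges, ∃ i j, e = s(u i, v j)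

/-- `ℓ(x)`: the length of a longest `M`-admissible path for `x`. -/
noncomputable def ellv (G : SimpleGraph V) {s : ℕ} (u v : Fin s → V) (x : V) : ℕ :=
  sSup {n | ∃ (b : V) (w : G.Walk x b), IsAdmissible u v w x ∧ w.length = n}

/-- `ℓ(M)`: the length of a longest `M`-alternating path in `G`. -/
noncomputable def ellM (G : SimpleGraph V) (M : Set (Sym2 V)) : ℕ :=
  sSup {n | ∃ (a b : V) (w : G.Walk a b), IsAlt M w ∧ w.length = n}

/-- `ℓ₀(M) = max {ℓ(x) : x ∈ B}`. -/
noncomputable def ell0 (G : SimpleGraph V) {s : ℕ} (u v : Fin s → V) : ℕ :=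
  sSup {n | ∃ i : Fin s, ellv G u v (v i) = n}

/-- `ℓ₁(M) = max {ℓ(x) + ℓ(y) + 1 : {x, y} ∈ E(G[B])}` (with the convention that this
is `0` when `B` is independent, since `sSup ∅ = 0`). -/
noncomputable def ell1 (G : SimpleGraph V) {s : ℕ} (u v : Fin s → V) : ℕ :=
  sSup {n | ∃ i j : Fin s, G.Adj (v i) (v j) ∧ ellv G u v (v i) + ellv G u v (v j) + 1 = n}

/-- `ℓ(G) = min {ℓ(M) : M a maximum ordered matching of G}`. -/
noncomputable def ellG (G : SimpleGraph V) : ℕ :=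
  sInf {n | ∃ u v : Fin (nu0 G) → V, IsOrderedMatching G u v ∧ ellM G (omEdges u v) = n}

open MvPolynomial in
/-- The `n`-th symbolic power `J(G)^{(n)} = ⋂_{{u,v} ∈ E(G)} (x_u, x_v)^n` of the cover
ideal of `G`. -/
noncomputable def symbPow (K : Type*) [Field K] (G : SimpleGraph V) (n : ℕ) :
    Ideal (MvPolynomial V K) :=
  ⨅ (p : V × V) (_ : G.Adj p.1 p.2), (Ideal.span {X p.1, X p.2}) ^ n

/-- The cover ideal `J(G) = ⋂_{{u,v} ∈ E(G)} (x_u, x_v)`. -/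
noncomputable def coverIdeal (K : Type*) [Field K] (G : SimpleGraph V) :
    Ideal (MvPolynomial V K) :=
  symbPow K G 1

/-- `depth R/I`: the length of a maximal `R/I`-regular sequence contained in the maximal
homogeneous ideal `(x_1, …, x_r)` of `R = K[x_1, …, x_r]`. -/
noncomputable def depthQ (K : Type*) [Field K] (I : Ideal (MvPolynomial V K)) : ℕ :=
  sSup {n | ∃ rs : List (MvPolynomial V K), rs.length = n ∧
    (∀ f ∈ rs, f ∈ Ideal.span (Set.range (MvPolynomial.X : V → MvPolynomial V K))) ∧
    RingTheory.Sequence.IsRegular (MvPolynomial V K ⧸ I) rs}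

/-- The stability index of the symbolic depth function of `J(G)`:
`sdst(J(G)) = min {n₀ ≥ 1 : depth R/J(G)^{(n)} = r − ν₀(G) − 1 for all n ≥ n₀}`. -/
noncomputable def sdst (K : Type*) [Field K] [Fintype V] (G : SimpleGraph V) : ℕ :=
  sInf {n0 | 1 ≤ n0 ∧ ∀ n, n0 ≤ n →
    depthQ K (symbPow K G n) = Fintype.card V - nu0 G - 1}

/-- The stability index of the depth function of `J(G)`:
the least `n₀ ≥ 1` such that `depth R/J(G)^n` is constant for `n ≥ n₀` (hence equal to
its limit value). -/
noncomputable def dst (K : Type*) [Field K] [Fintype V] (G : SimpleGraph V) : ℕ :=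
  sInf {n0 | 1 ≤ n0 ∧ ∀ m n, n0 ≤ m → n0 ≤ n →
    depthQ K (coverIdeal K G ^ m) = depthQ K (coverIdeal K G ^ n)}

end DS

namespace Koszul

section Differential

variable {ι : Type*} [LinearOrder ι]

/-- The sign `(-1) ^ k`, where `k` is the number of elements of `σ` below `j`. -/
def sgn (R : Type*) [CommRing R] (j : ι) (σ : Finset ι) : R :=
  (-1) ^ (σ.filter (· < j)).card

variable {R : Type*} [CommRing R]

lemma sgn_mul_self (j : ι) (σ : Finset ι) : sgn R j σ * sgn R j σ = 1 := by
  rw [sgn, ← mul_pow]; simp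

lemma sgn_ne_zero [Nontrivial R] (j : ι) (σ : Finset ι) : sgn R j σ ≠ 0 := fun h => by
  simpa [h] using sgn_mul_self (R := R) j σ

lemma sgn_erase_self (j : ι) (σ : Finset ι) : sgn R j (σ.erase j) = sgn R j σ := by
  rw [sgn, sgn]
  congr 2
  ext k
  simp only [Finset.mem_filter, Finset.mem_erase]
  exact ⟨fun h => ⟨h.1.2, h.2⟩, fun h => ⟨⟨h.2.ne, h.1⟩, h.2⟩⟩

lemma sgn_insert_self (j : ι) (σ : Finset ι) : sgn R j (insert j σ) = sgn R j σ := by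
  rw [← sgn_erase_self, ← sgn_erase_self j σ, Finset.erase_insert_eq_erase]

lemma sgn_insert_of_lt {j w : ι} {σ : Finset ι} (h : w < j) (hw : w ∉ σ) :
    sgn R j (insert w σ) = - sgn R j σ := by
  rw [sgn, sgn, Finset.filter_insert, if_pos h, Finset.card_insert_of_notMem (by simp [hw]),
    pow_succ]
  simp

lemma sgn_insert_of_gt {j w : ι} {σ : Finset ι} (h : j < w) :
    sgn R j (insert w σ) = sgn R j σ := by
  rw [sgn, sgn, Finset.filter_insert, if_neg h.not_gt]

lemma sgn_swap {j w : ι} {σ : Finset ι} (hj : j ∈ σ) (hw : w ∉ σ) :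
    sgn R j (insert w σ) * sgn R w (σ.erase j) = - (sgn R w σ * sgn R j σ) := by
  obtain ⟨τ, hτ, rfl⟩ : ∃ τ, j ∉ τ ∧ σ = insert j τ :=
    ⟨σ.erase j, Finset.notMem_erase _ _, (Finset.insert_erase hj).symm⟩
  have hwτ : w ∉ τ := fun h => hw (Finset.mem_insert_of_mem h)
  have hne : w ≠ j := fun h => hw (h ▸ hj)
  rw [Finset.erase_insert hτ, sgn_insert_self, Finset.insert_comm, sgn_insert_self]
  rcases lt_or_gt_of_ne hne with h | h
  · rw [sgn_insert_of_lt h hwτ, sgn_insert_of_gt h]; ring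
  · rw [sgn_insert_of_gt h, sgn_insert_of_lt h hτ]; ring

variable {M N : Type*} [AddCommGroup M] [Module R M] [AddCommGroup N] [Module R N]

/-- The Koszul differential on `M`-valued cochains indexed by finite subsets of `ι`. -/
def kd (x : ι → R) : (Finset ι → M) →ₗ[R] (Finset ι → M) where
  toFun f σ := ∑ j ∈ σ, (sgn R j σ * x j) • f (σ.erase j)
  map_add' f g := by ext σ; simp [Finset.sum_add_distrib]
  map_smul' c f := by
    ext σ
    simp only [Pi.smul_apply, RingHom.id_apply, Finset.smul_sum]
    exact Finset.sum_congr rfl fun j _ => smul_comm _ _ _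

lemma kd_apply (x : ι → R) (f : Finset ι → M) (σ : Finset ι) :
    kd x f σ = ∑ j ∈ σ, (sgn R j σ * x j) • f (σ.erase j) := rfl

/-- Contraction with the `w`-th basis vector. -/
def contr (R : Type*) [CommRing R] [Module R M] (w : ι) :
    (Finset ι → M) →ₗ[R] (Finset ι → M) where
  toFun f σ := if w ∈ σ then 0 else sgn R w σ • f (insert w σ)
  map_add' f g := by ext σ; simp only [Pi.add_apply]; split_ifs <;> simp
  map_smul' c f := by
    ext σ
    simp only [Pi.smul_apply, RingHom.id_apply]
    split_ifs
    · simp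
    · exact smul_comm _ _ _

lemma contr_of_notMem {w : ι} {σ : Finset ι} (h : w ∉ σ) (f : Finset ι → M) :
    contr R w f σ = sgn R w σ • f (insert w σ) := if_neg h

lemma contr_of_mem {w : ι} {σ : Finset ι} (h : w ∈ σ) (f : Finset ι → M) :
    contr R w f σ = 0 := if_pos h

lemma kd_congr (x : ι → R) {f g : Finset ι → M} {σ : Finset ι}
    (h : ∀ j ∈ σ, f (σ.erase j) = g (σ.erase j)) : kd x f σ = kd x g σ :=
  Finset.sum_congr rfl fun j hj => by rw [h j hj]

lemma kd_comp (x : ι → R) (φ : M →ₗ[R] N) (f : Finset ι → M) (σ : Finset ι) :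
    kd x (fun τ => φ (f τ)) σ = φ (kd x f σ) := by
  simp [kd_apply]

lemma kd_insert (x : ι → R) (f : Finset ι → M) {w : ι} {σ : Finset ι} (hw : w ∉ σ) :
    kd x f (insert w σ) = sgn R w σ • (x w • f σ - kd x (contr R w f) σ) := by
  rw [kd_apply, Finset.sum_insert hw, Finset.erase_insert hw, sgn_insert_self, kd_apply,
    smul_sub, sub_eq_add_neg, smul_smul, Finset.smul_sum, ← Finset.sum_neg_distrib]
  congr 1
  refine Finset.sum_congr rfl fun j hj => ?_
  have hne : j ≠ w := fun h => hw (h ▸ hj)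
  rw [contr_of_notMem (fun h => hw (Finset.mem_of_mem_erase h)), smul_smul, smul_smul,
    Finset.erase_insert_of_ne hne.symm, ← neg_smul]
  congr 1
  have h := sgn_swap (R := R) hj hw
  have h2 := sgn_mul_self (R := R) w (σ.erase j)
  linear_combination x j * sgn R w (σ.erase j) * h - sgn R j (insert w σ) * x j * h2

lemma kd_contr_add (x : ι → R) (f : Finset ι → M) (w : ι) (σ : Finset ι) :
    kd x (contr R w f) σ + contr R w (kd x f) σ = x w • f σ := by
  by_cases hw : w ∈ σ
  · rw [contr_of_mem hw, add_zero, kd_apply, Finset.sum_eq_single_of_mem w hw,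
      contr_of_notMem (Finset.notMem_erase _ _), Finset.insert_erase hw, smul_smul,
      sgn_erase_self]
    · congr 1
      linear_combination x w * sgn_mul_self (R := R) w σ
    · intro j _ hj
      rw [contr_of_mem (Finset.mem_erase.2 ⟨hj.symm, hw⟩), smul_zero]
  · rw [contr_of_notMem hw, kd_insert x f hw, smul_smul, sgn_mul_self, one_smul]
    abel

lemma kd_kd (x : ι → R) (f : Finset ι → M) (σ : Finset ι) : kd x (kd x f) σ = 0 := by
  induction σ using Finset.induction_on generalizing f with
  | empty => simp [kd_apply]
  | insert w σ hw ih =>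
    rw [kd_insert x _ hw]
    have h : kd x (contr R w (kd x f)) σ = x w • kd x f σ := by
      have h1 : contr R w (kd x f) = x w • f - kd x (contr R w f) := by
        ext τ
        rw [Pi.sub_apply, Pi.smul_apply, ← kd_contr_add x f w τ]; abel
      rw [h1, map_sub, map_smul, Pi.sub_apply, Pi.smul_apply, ih, sub_zero]
    rw [h, sub_self, smul_zero]

end Differential

end Koszul

namespace Koszul

section Vanishing

variable {ι : Type*} [LinearOrder ι] {R : Type*} [CommRing R]
variable {M N Q : Type*} [AddCommGroup M] [Module R M] [AddCommGroup N] [Module R N]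
  [AddCommGroup Q] [Module R Q]

/-- Vanishing of the `i`-th Koszul cohomology of `M` with respect to `x`. -/
def Van (x : ι → R) (M : Type*) [AddCommGroup M] [Module R M] (i : ℕ) : Prop :=
  ∀ f : Finset ι → M, (∀ σ, σ.card = i + 1 → kd x f σ = 0) →
    ∃ g : Finset ι → M, ∀ σ, σ.card = i → kd x g σ = f σ

lemma kd_congr_card (x : ι → R) {f g : Finset ι → M} {i : ℕ}
    (h : ∀ σ, σ.card = i → f σ = g σ) {σ : Finset ι} (hσ : σ.card = i + 1) :
    kd x f σ = kd x g σ :=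
  kd_congr x fun j hj => h _ (by rw [Finset.card_erase_of_mem hj, hσ]; rfl)

lemma exists_kd_eq_smul (x : ι → R) {c : R} (hc : c ∈ Ideal.span (Set.range x))
    (f : Finset ι → M) {i : ℕ} (hf : ∀ σ, σ.card = i + 1 → kd x f σ = 0) :
    ∃ g : Finset ι → M, ∀ σ, σ.card = i → kd x g σ = c • f σ := by
  induction hc using Submodule.span_induction with
  | mem c hc =>
    obtain ⟨w, rfl⟩ := hc
    refine ⟨contr R w f, fun σ hσ => ?_⟩
    rw [← kd_contr_add x f w σ, left_eq_add]
    by_cases hw : w ∈ σ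
    · exact contr_of_mem hw _
    · rw [contr_of_notMem hw, hf _ (by rw [Finset.card_insert_of_notMem hw, hσ]), smul_zero]
  | zero => exact ⟨0, fun σ _ => by simp⟩
  | add a b _ _ ha hb =>
    obtain ⟨g, hg⟩ := ha
    obtain ⟨g', hg'⟩ := hb
    exact ⟨g + g', fun σ hσ => by rw [map_add, Pi.add_apply, hg σ hσ, hg' σ hσ, add_smul]⟩
  | smul a b _ hb =>
    obtain ⟨g, hg⟩ := hb
    exact ⟨a • g, fun σ hσ => by rw [map_smul, Pi.smul_apply, hg σ hσ, smul_eq_mul, mul_smul]⟩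

lemma Van.quotient (x : ι → R) {φ : N →ₗ[R] M} {ψ : M →ₗ[R] Q} (hφ : Function.Injective φ)
    (hψ : Function.Surjective ψ) (hex : Function.Exact φ ψ) {i : ℕ} (hM : Van x M i)
    (hN : Van x N (i + 1)) : Van x Q i := by
  intro f hf
  choose F hF using fun σ => hψ (f σ)
  have h1 : ∀ σ, ∃ y : N, σ.card = i + 1 → φ y = kd x F σ := by
    intro σ
    by_cases hσ : σ.card = i + 1
    · obtain ⟨y, hy⟩ := (hex (kd x F σ)).1 (by
        rw [← kd_comp]
        simpa only [hF] using hf σ hσ)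
      exact ⟨y, fun _ => hy⟩
    · exact ⟨0, fun h => absurd h hσ⟩
  choose h hh using h1
  obtain ⟨g, hg⟩ := hN h fun σ hσ => hφ (by
    rw [← kd_comp, kd_congr_card x (g := kd x F) hh hσ, kd_kd, map_zero])
  obtain ⟨p, hp⟩ := hM (F - fun σ => φ (g σ)) fun σ hσ => by
    rw [map_sub, Pi.sub_apply, kd_comp, hg σ hσ, hh σ hσ, sub_self]
  refine ⟨fun σ => ψ (p σ), fun σ hσ => ?_⟩
  rw [kd_comp, hp σ hσ, Pi.sub_apply, map_sub, hF, hex.apply_apply_eq_zero, sub_zero]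

lemma Van.sub_of_quotient (x : ι → R) {φ : N →ₗ[R] M} {ψ : M →ₗ[R] Q}
    (hφ : Function.Injective φ) (hψ : Function.Surjective ψ) (hex : Function.Exact φ ψ) {i : ℕ}
    (hM : ∀ f : Finset ι → N, (∀ σ, σ.card = i + 2 → kd x f σ = 0) →
      ∃ g : Finset ι → M, ∀ σ, σ.card = i + 1 → kd x g σ = φ (f σ))
    (hQ : Van x Q i) : Van x N (i + 1) := by
  intro f hf
  obtain ⟨g, hg⟩ := hM f hf
  obtain ⟨h, hh⟩ := hQ (fun σ => ψ (g σ)) fun σ hσ => by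
    rw [kd_comp, hg σ hσ, hex.apply_apply_eq_zero]
  choose H hH using fun σ => hψ (h σ)
  have h1 : ∀ σ, ∃ y : N, σ.card = i → φ y = g σ - kd x H σ := by
    intro σ
    by_cases hσ : σ.card = i
    · obtain ⟨y, hy⟩ := (hex (g σ - kd x H σ)).1 (by
        rw [map_sub, ← kd_comp]
        simp only [hH]
        rw [hh σ hσ, sub_self])
      exact ⟨y, fun _ => hy⟩
    · exact ⟨0, fun h => absurd h hσ⟩
  choose p hp using h1
  refine ⟨p, fun σ hσ => hφ ?_⟩
  rw [← kd_comp, kd_congr_card x (g := g - kd x H) hp hσ, map_sub, Pi.sub_apply, kd_kd, sub_zero,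
    hg σ hσ]

open scoped Pointwise in
lemma exact_smul_mkQ (c : R) :
    Function.Exact (LinearMap.lsmul R M c) (Submodule.mkQ (c • (⊤ : Submodule R M))) := by
  intro y
  rw [Submodule.mkQ_apply, Submodule.Quotient.mk_eq_zero, Submodule.mem_smul_pointwise_iff_exists]
  simp

lemma Van.quotSMulTop (x : ι → R) {c : R} (hc : IsSMulRegular M c) {i : ℕ} (h : Van x M i)
    (h' : Van x M (i + 1)) : Van x (QuotSMulTop c M) i :=
  Van.quotient x (φ := LinearMap.lsmul R M c) (ψ := Submodule.mkQ _) hc (Submodule.mkQ_surjective _)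
    (exact_smul_mkQ c) h h'

lemma Van.of_quotSMulTop (x : ι → R) {c : R} (hcx : c ∈ Ideal.span (Set.range x))
    (hc : IsSMulRegular M c) {i : ℕ} (h : Van x (QuotSMulTop c M) i) : Van x M (i + 1) :=
  Van.sub_of_quotient x (φ := LinearMap.lsmul R M c) (ψ := Submodule.mkQ _) hc
    (Submodule.mkQ_surjective _) (exact_smul_mkQ c)
    (fun f hf => exists_kd_eq_smul x hcx f hf) h

lemma Van.zero_of_isSMulRegular (x : ι → R) {c : R} (hcx : c ∈ Ideal.span (Set.range x))
    (hc : IsSMulRegular M c) : Van x M 0 := by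
  intro f hf
  obtain ⟨g, hg⟩ := exists_kd_eq_smul x hcx f hf
  refine ⟨0, fun σ hσ => ?_⟩
  have h := hg σ hσ
  rw [Finset.card_eq_zero.1 hσ] at h ⊢
  refine hc ?_
  simpa [kd_apply] using h

lemma van_of_isWeaklyRegular (x : ι → R) (rs : List R) :
    ∀ (M : Type _) [AddCommGroup M] [Module R M], (∀ c ∈ rs, c ∈ Ideal.span (Set.range x)) →
    RingTheory.Sequence.IsWeaklyRegular M rs → ∀ i < rs.length, Van x M i := by
  induction rs with
  | nil => intro M _ _ _ _ i hi; simp at hi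
  | cons c rs ih =>
    intro M _ _ hmem hreg i hi
    rw [RingTheory.Sequence.isWeaklyRegular_cons_iff] at hreg
    have hc := hmem c List.mem_cons_self
    cases i with
    | zero => exact Van.zero_of_isSMulRegular x hc hreg.1
    | succ i =>
      exact Van.of_quotSMulTop x hc hreg.1
        (ih _ (fun a ha => hmem a (List.mem_cons_of_mem _ ha)) hreg.2 i
          (by simpa using hi))

lemma exists_isSMulRegular [IsNoetherianRing R] [Module.Finite R M] (x : ι → R)
    (h : Van x M 0) : ∃ c ∈ Ideal.span (Set.range x), IsSMulRegular M c := by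
  by_contra! hcon
  have hsub : (Ideal.span (Set.range x) : Set R) ⊆ ⋃ p ∈ associatedPrimes R M, (p : Set R) := by
    rw [biUnion_associatedPrimes_eq_zero_divisors]
    intro c hc
    have := hcon c hc
    rw [isSMulRegular_iff_right_eq_zero_of_smul] at this
    push Not at this
    obtain ⟨y, hy, hy0⟩ := this
    exact ⟨y, hy0, hy⟩
  obtain ⟨P, hP, hle⟩ := (Ideal.subset_union_prime_finite (associatedPrimes.finite R M) (f := id)
    0 0 fun p hp _ _ => hp.isPrime).1 hsub
  rw [AssociatedPrimes.mem_iff, isAssociatedPrime_iff] at hP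
  obtain ⟨hprime, y, rfl⟩ := hP
  have hy : ∀ j, x j • y = 0 := fun j => by
    simpa using hle (Ideal.subset_span (Set.mem_range_self j))
  obtain ⟨g, hg⟩ := h (fun _ => y) fun σ _ => by
    rw [kd_apply]
    exact Finset.sum_eq_zero fun j _ => by rw [mul_smul, hy, smul_zero]
  have hy0 : y = 0 := by
    rw [← hg ∅ rfl]; simp [kd_apply]
  exact hprime.ne_top (by simp [hy0])

lemma exists_isWeaklyRegular [IsNoetherianRing R] (x : ι → R) (d : ℕ) :
    ∀ (M : Type _) [AddCommGroup M] [Module R M] [Module.Finite R M], (∀ i < d, Van x M i) →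
    ∃ rs : List R, rs.length = d ∧ (∀ c ∈ rs, c ∈ Ideal.span (Set.range x)) ∧
      RingTheory.Sequence.IsWeaklyRegular M rs := by
  induction d with
  | zero => intro M _ _ _ _; exact ⟨[], rfl, by simp, RingTheory.Sequence.IsWeaklyRegular.nil R M⟩
  | succ d ih =>
    intro M _ _ _ h
    obtain ⟨c, hc, hreg⟩ := exists_isSMulRegular x (h 0 (Nat.succ_pos d))
    obtain ⟨rs, hlen, hmem, hrs⟩ := ih (QuotSMulTop c M) fun i hi =>
      Van.quotSMulTop x hreg (h i (by omega)) (h (i + 1) (by omega))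
    refine ⟨c :: rs, by simp [hlen], ?_, ?_⟩
    · intro a ha
      rcases List.mem_cons.1 ha with rfl | ha
      exacts [hc, hmem a ha]
    · exact (RingTheory.Sequence.isWeaklyRegular_cons_iff M c rs).2 ⟨hreg, hrs⟩

lemma not_van_card [Fintype ι] (x : ι → R)
    (hM : Ideal.span (Set.range x) • (⊤ : Submodule R M) ≠ ⊤) : ¬ Van x M (Fintype.card ι) := by
  intro h
  refine hM (eq_top_iff.2 fun y _ => ?_)
  obtain ⟨g, hg⟩ := h (fun _ => y) fun σ hσ => by
    have := Finset.card_le_univ σ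
    omega
  rw [← hg Finset.univ rfl, kd_apply]
  exact Submodule.sum_mem _ fun j _ => Submodule.smul_mem_smul
    (Ideal.mul_mem_left _ _ (Ideal.subset_span (Set.mem_range_self j))) trivial

end Vanishing

end Koszul

namespace Koszul

section Covers

/-- `σ` contains `S` and covers every edge of `H` inside `W`. -/
def Cov {ι : Type*} (H : SimpleGraph ι) (S W σ : Finset ι) : Prop :=
  S ⊆ σ ∧ ∀ x ∈ W, ∀ y ∈ W, H.Adj x y → x ∈ σ ∨ y ∈ σ

lemma Cov.mono {ι : Type*} (H : SimpleGraph ι) {S W σ τ : Finset ι} (h : σ ⊆ τ)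
    (hσ : Cov H S W σ) : Cov H S W τ :=
  ⟨hσ.1.trans h, fun x hx y hy hxy => (hσ.2 x hx y hy hxy).imp (@h x) (@h y)⟩

variable {ι : Type*} [LinearOrder ι]

/-- Vanishing of the `i`-th cohomology of the complex of `K`-valued cochains supported on the
subsets of `W` satisfying `p`. -/
def VanOn (K : Type*) [CommRing K] (W : Finset ι) (p : Finset ι → Prop) (i : ℕ) : Prop :=
  ∀ f : Finset ι → K, (∀ σ ⊆ W, ¬ p σ → f σ = 0) →
    (∀ σ ⊆ W, σ.card = i + 1 → kd (fun _ => (1 : K)) f σ = 0) →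
    ∃ g : Finset ι → K, (∀ σ ⊆ W, ¬ p σ → g σ = 0) ∧
      ∀ σ ⊆ W, σ.card = i → kd (fun _ => (1 : K)) g σ = f σ

variable {K : Type*} [CommRing K]

lemma VanOn.congr {W : Finset ι} {p q : Finset ι → Prop} (hpq : ∀ σ ⊆ W, (p σ ↔ q σ)) {i : ℕ}
    (h : VanOn K W p i) : VanOn K W q i := by
  intro f hf hf'
  obtain ⟨g, hg, hg'⟩ := h f (fun σ hσ hp => hf σ hσ (by rwa [← hpq σ hσ])) hf'
  exact ⟨g, fun σ hσ hq => hg σ hσ (by rwa [hpq σ hσ]), hg'⟩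

lemma VanOn.of_forall_not {W : Finset ι} {p : Finset ι → Prop} (hp : ∀ σ ⊆ W, ¬ p σ) (i : ℕ) :
    VanOn K W p i := fun f hf _ =>
  ⟨0, fun _ _ _ => rfl, fun σ hσ _ => by rw [hf σ hσ (hp σ hσ), map_zero, Pi.zero_apply]⟩

lemma vanOn_insert {W : Finset ι} {w : ι} (hw : w ∉ W) {p : Finset ι → Prop}
    (hp : ∀ σ ⊆ W, p σ → p (insert w σ)) {i : ℕ} (h0 : VanOn K W p i)
    (h1 : ∀ k, i = k + 1 → VanOn K W (fun σ => p (insert w σ)) k) :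
    VanOn K (insert w W) p i := by
  intro f hf hf'
  have hsub : ∀ {σ}, σ ⊆ W → σ ⊆ insert w W := fun h => h.trans (Finset.subset_insert _ _)
  have hnot : ∀ {σ}, σ ⊆ W → w ∉ σ := fun h h' => hw (h h')
  obtain ⟨g0, hg0, hg0'⟩ := h0 f (fun σ hσ => hf σ (hsub hσ)) (fun σ hσ => hf' σ (hsub hσ))
  obtain ⟨g1, hg1, hg1'⟩ : ∃ g1 : Finset ι → K, (∀ σ ⊆ W, ¬ p (insert w σ) → g1 σ = 0) ∧
      ∀ σ ⊆ W, σ.card + 1 = i → kd (fun _ => (1 : K)) g1 σ = contr K w f σ - g0 σ := by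
    cases i with
    | zero => exact ⟨0, fun _ _ _ => rfl, fun σ _ h => by omega⟩
    | succ k =>
      obtain ⟨g1, hg1, hg1'⟩ := h1 k rfl (contr K w f - g0) (fun σ hσ hpσ => by
          rw [Pi.sub_apply, contr_of_notMem (hnot hσ), hf _ (Finset.insert_subset_insert _ hσ) hpσ,
            hg0 σ hσ fun h => hpσ (hp σ hσ h), smul_zero, sub_zero]) (fun σ hσ hc => by
          have h2 := kd_contr_add (fun _ => (1 : K)) f w σ
          rw [contr_of_notMem (hnot hσ), hf' _ (Finset.insert_subset_insert _ hσ)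
            (by rw [Finset.card_insert_of_notMem (hnot hσ), hc]), smul_zero, add_zero,
            one_smul] at h2
          rw [map_sub, Pi.sub_apply, h2, hg0' σ hσ hc, sub_self])
      exact ⟨g1, hg1, fun σ hσ hc => hg1' σ hσ (by omega)⟩
  refine ⟨fun σ => if w ∈ σ then - (sgn K w σ * g1 (σ.erase w)) else g0 σ, ?_, ?_⟩
  · intro σ hσ hpσ
    by_cases hwσ : w ∈ σ
    · simp only [hwσ, if_true]
      rw [hg1 _ (Finset.subset_insert_iff.1 hσ) (by rwa [Finset.insert_erase hwσ]), mul_zero,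
        neg_zero]
    · simp only [hwσ, if_false]
      exact hg0 σ ((Finset.subset_insert_iff_of_notMem hwσ).1 hσ) hpσ
  · intro σ hσ hc
    by_cases hwσ : w ∈ σ
    · obtain ⟨τ, hτ, rfl⟩ : ∃ τ, w ∉ τ ∧ σ = insert w τ :=
        ⟨σ.erase w, Finset.notMem_erase _ _, (Finset.insert_erase hwσ).symm⟩
      have hτW : τ ⊆ W := fun a ha => by
        rcases Finset.mem_insert.1 (hσ (Finset.mem_insert_of_mem ha)) with rfl | h
        exacts [absurd ha hτ, h]
      rw [Finset.card_insert_of_notMem hτ] at hc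
      rw [kd_insert _ _ hτ, kd_congr (g := - g1), map_neg, Pi.neg_apply, hg1' τ hτW hc]
      · simp only [hτ, if_false]
        rw [one_smul, sub_neg_eq_add, add_sub_cancel, contr_of_notMem hτ, smul_smul,
          sgn_mul_self, one_smul]
      · intro j hj
        have hj' : w ∉ τ.erase j := fun h => hτ (Finset.mem_of_mem_erase h)
        rw [contr_of_notMem hj', if_pos (Finset.mem_insert_self _ _), Finset.erase_insert hj',
          sgn_insert_self, smul_eq_mul, Pi.neg_apply]
        linear_combination (- g1 (τ.erase j)) * sgn_mul_self (R := K) w (τ.erase j)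
    · have hσW := (Finset.subset_insert_iff_of_notMem hwσ).1 hσ
      rw [← hg0' σ hσW hc]
      exact kd_congr _ fun j _ => if_neg fun h => hwσ (Finset.mem_of_mem_erase h)

lemma vanOn_insert_of_cone {W : Finset ι} {w : ι} {p : Finset ι → Prop}
    (hp : ∀ σ ⊆ W, p (insert w σ) → p σ) (i : ℕ) :
    VanOn K (insert w W) p i := by
  intro f hf hf'
  refine ⟨contr K w f, fun σ hσ hpσ => ?_, fun σ hσ hc => ?_⟩
  · by_cases hwσ : w ∈ σ
    · exact contr_of_mem hwσ _
    · have hσW := (Finset.subset_insert_iff_of_notMem hwσ).1 hσ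
      rw [contr_of_notMem hwσ, hf _ (Finset.insert_subset_insert _ hσW) fun h => hpσ (hp σ hσW h),
        smul_zero]
  · have h2 := kd_contr_add (fun _ => (1 : K)) f w σ
    by_cases hwσ : w ∈ σ
    · rwa [contr_of_mem hwσ (kd _ f), add_zero, one_smul] at h2
    · rwa [contr_of_notMem hwσ (kd _ f),
        hf' _ (Finset.insert_subset (Finset.mem_insert_self _ _) hσ)
        (by rw [Finset.card_insert_of_notMem hwσ, hc]), smul_zero, add_zero, one_smul] at h2

variable (H : SimpleGraph ι)

lemma cov_insert_insert {S W : Finset ι} {w : ι} (hw : w ∉ W) {σ : Finset ι} :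
    Cov H S (insert w W) (insert w σ) ↔ Cov H (S.erase w) W σ := by
  have hne : ∀ x ∈ W, x ≠ w := fun x hx h => hw (h ▸ hx)
  rw [Cov, Cov, Finset.subset_insert_iff]
  refine and_congr_right fun _ => ⟨fun h x hx y hy hxy => ?_, fun h x hx y hy hxy => ?_⟩
  · simpa [hne x hx, hne y hy] using
      h x (Finset.mem_insert_of_mem hx) y (Finset.mem_insert_of_mem hy) hxy
  · rcases Finset.mem_insert.1 hx with rfl | hx
    · exact Or.inl (Finset.mem_insert_self _ _)
    rcases Finset.mem_insert.1 hy with rfl | hy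
    · exact Or.inr (Finset.mem_insert_self _ _)
    exact (h x hx y hy hxy).imp Finset.mem_insert_of_mem Finset.mem_insert_of_mem

open Classical in
lemma cov_insert_of_subset {S W : Finset ι} {w : ι} {σ : Finset ι} (hσ : w ∉ σ) :
    Cov H S (insert w W) σ ↔ Cov H (S ∪ W.filter (H.Adj w)) W σ := by
  rw [Cov, Cov, Finset.union_subset_iff, and_assoc]
  refine and_congr_right fun _ => ⟨fun h => ⟨fun y hy => ?_, fun x hx y hy hxy => ?_⟩,
    fun h x hx y hy hxy => ?_⟩
  · rw [Finset.mem_filter] at hy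
    exact (h w (Finset.mem_insert_self _ _) y (Finset.mem_insert_of_mem hy.1) hy.2).resolve_left hσ
  · exact h x (Finset.mem_insert_of_mem hx) y (Finset.mem_insert_of_mem hy) hxy
  · rcases Finset.mem_insert.1 hx with rfl | hx
    · rcases Finset.mem_insert.1 hy with rfl | hy
      · exact absurd hxy (H.loopless.irrefl _)
      · exact Or.inr (h.1 (Finset.mem_filter.2 ⟨hy, hxy⟩))
    rcases Finset.mem_insert.1 hy with hy | hy
    · exact Or.inl (h.1 (Finset.mem_filter.2 ⟨hx, hy ▸ hxy.symm⟩))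
    exact h.2 x hx y hy hxy

lemma vanOn_cov_of_isolated {W : Finset ι} {w : ι} (hw : w ∉ W) (hiso : ∀ y ∈ W, ¬ H.Adj w y)
    (i : ℕ) : VanOn K (insert w W) (Cov H ∅ (insert w W)) i := by
  classical
  refine vanOn_insert_of_cone (K := K) (fun σ hσ h => ?_) i
  rw [cov_insert_insert H hw] at h
  rw [cov_insert_of_subset H fun h => hw (hσ h), Finset.filter_false_of_mem hiso]
  simpa using h

open Classical in
lemma vanOn_cov_insert {S W : Finset ι} {w : ι} (hw : w ∉ W) {i : ℕ}
    (h0 : w ∉ S → VanOn K W (Cov H (S ∪ W.filter (H.Adj w)) W) i)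
    (h1 : ∀ k, i = k + 1 → VanOn K W (Cov H (S.erase w) W) k) :
    VanOn K (insert w W) (Cov H S (insert w W)) i := by
  refine vanOn_insert (p := Cov H S (insert w W)) hw
    (fun σ _ => Cov.mono H (Finset.subset_insert _ _)) ?_ fun k hk =>
      (h1 k hk).congr fun σ _ => (cov_insert_insert H hw).symm
  by_cases hwS : w ∈ S
  · exact VanOn.of_forall_not (K := K) (fun σ hσ h => hw (hσ (h.1 hwS))) i
  · exact (h0 hwS).congr fun σ hσ => (cov_insert_of_subset H fun h => hw (hσ h)).symm

lemma vanOn_cov (W : Finset ι) : ∀ (S : Finset ι) (i : ℕ), S ⊆ W → 2 * i < W.card + S.card →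
    VanOn K W (Cov H S W) i := by
  classical
  induction hn : W.card generalizing W with
  | zero =>
    intro S i hS hi
    rw [Finset.card_eq_zero] at hn
    subst hn
    rw [Finset.subset_empty.1 hS] at hi
    simp at hi
  | succ n ih =>
    intro S i hS hi
    have key : ∀ w ∈ W, ((w ∈ S) ∨ (S = ∅ ∧ ∃ y ∈ W, H.Adj w y)) →
        VanOn K W (Cov H S W) i := by
      intro w hw hor
      have hins := Finset.insert_erase hw
      have hcard := Finset.card_erase_of_mem hw
      have hnot := Finset.notMem_erase w W
      generalize W.erase w = W' at *
      subst hins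
      refine vanOn_cov_insert H hnot (fun hwS => ?_) fun k hk => ?_
      · obtain ⟨rfl, y, hy, hwy⟩ := hor.resolve_left hwS
        rcases Finset.mem_insert.1 hy with rfl | hy
        · exact absurd hwy (H.loopless.irrefl _)
        refine ih W' (by omega) _ i (by simp) ?_
        have : 0 < (W'.filter (H.Adj w)).card :=
          Finset.card_pos.2 ⟨y, Finset.mem_filter.2 ⟨hy, hwy⟩⟩
        rw [Finset.empty_union]
        simp only [Finset.card_empty] at hi
        omega
      · refine ih W' (by omega) _ k (Finset.subset_insert_iff.1 hS) ?_
        have := Finset.pred_card_le_card_erase (s := S) (a := w)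
        omega
    by_cases hSe : S.Nonempty
    · obtain ⟨w, hw⟩ := hSe
      exact key w (hS hw) (Or.inl hw)
    rw [Finset.not_nonempty_iff_eq_empty] at hSe
    subst hSe
    obtain ⟨w, hw⟩ : W.Nonempty := Finset.card_pos.1 (by omega)
    by_cases hy : ∃ y ∈ W, H.Adj w y
    · exact key w hw (Or.inr ⟨rfl, hy⟩)
    push Not at hy
    rw [← Finset.insert_erase hw]
    exact vanOn_cov_of_isolated H (Finset.notMem_erase _ _)
      (fun y hy' => hy y (Finset.mem_of_mem_erase hy')) i

lemma existsUnique_adj_of_not_vanOn [Fintype ι] {S : Finset ι} {i : ℕ}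
    (hi : 2 * i = Fintype.card ι) (h : ¬ VanOn K Finset.univ (Cov H S Finset.univ) i) :
    S = ∅ ∧ ∀ w, ∃! y, H.Adj w y := by
  classical
  have hS : S = ∅ := by
    by_contra hS
    have := Finset.card_pos.2 (Finset.nonempty_iff_ne_empty.2 hS)
    exact h (vanOn_cov H _ S i (Finset.subset_univ _) (by rw [Finset.card_univ]; omega))
  refine ⟨hS, fun w => ?_⟩
  subst hS
  have hins := Finset.insert_erase (Finset.mem_univ w)
  have hnot := Finset.notMem_erase w Finset.univ
  have hcard := Finset.card_erase_of_mem (Finset.mem_univ w)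
  have hall : ∀ y, H.Adj w y → y ∈ Finset.univ.erase w := fun y hy =>
    Finset.mem_erase.2 ⟨hy.ne', Finset.mem_univ _⟩
  have hpos : 0 < Fintype.card ι := Fintype.card_pos_iff.2 ⟨w⟩
  rw [Finset.card_univ] at hcard
  generalize Finset.univ.erase w = W at *
  rw [← hins] at h
  have h1 : ∃ y, H.Adj w y := by
    by_contra! hno
    exact h (vanOn_cov_of_isolated H hnot (fun y _ => hno y) i)
  obtain ⟨y, hy⟩ := h1
  refine ⟨y, hy, fun z hz => ?_⟩
  by_contra hne
  refine h (vanOn_cov_insert H hnot (fun _ => ?_) fun k hk => ?_)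
  · rw [Finset.empty_union]
    refine vanOn_cov H W _ i (Finset.filter_subset _ _) ?_
    have : 2 ≤ (W.filter (H.Adj w)).card := by
      rw [← Finset.card_pair hne]
      refine Finset.card_le_card fun a ha => ?_
      rcases Finset.mem_insert.1 ha with rfl | ha
      · exact Finset.mem_filter.2 ⟨hall _ hz, hz⟩
      · rw [Finset.mem_singleton.1 ha]
        exact Finset.mem_filter.2 ⟨hall _ hy, hy⟩
    omega
  · exact vanOn_cov H W _ k (by simp) (by omega)

end Covers

end Koszul

namespace Koszul

section SymbolicPowers

open MvPolynomial

variable {ι : Type*} {K : Type*} [Field K]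

/-- The ideal of polynomials all of whose monomials have degree at least `n` in `x` and `y`
together. -/
def pairIdeal (K : Type*) [Field K] (x y : ι) (n : ℕ) : Ideal (MvPolynomial ι K) where
  carrier := {q | ∀ m ∈ q.support, n ≤ m x + m y}
  zero_mem' := by simp
  add_mem' := by
    classical
    intro a b ha hb m hm
    rcases Finset.mem_union.1 (support_add hm) with h | h
    exacts [ha m h, hb m h]
  smul_mem' := by
    classical
    intro c q hq m hm
    obtain ⟨m₁, -, m₂, h₂, rfl⟩ := Finset.mem_add.1 (support_mul c q hm)
    have := hq m₂ h₂
    simp only [Finsupp.add_apply]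
    omega

lemma pairIdeal_mul_le (x y : ι) (n k : ℕ) :
    pairIdeal K x y n * pairIdeal K x y k ≤ pairIdeal K x y (n + k) := by
  classical
  refine Ideal.mul_le.2 fun a ha b hb m hm => ?_
  obtain ⟨m₁, h₁, m₂, h₂, rfl⟩ := Finset.mem_add.1 (support_mul a b hm)
  have h1 := ha m₁ h₁
  have h2 := hb m₂ h₂
  simp only [Finsupp.add_apply]
  omega

lemma span_pair_pow_eq {x y : ι} (hxy : x ≠ y) (n : ℕ) :
    Ideal.span {(X x : MvPolynomial ι K), X y} ^ n = pairIdeal K x y n := by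
  classical
  refine le_antisymm ?_ fun q hq => ?_
  · induction n with
    | zero => exact fun q _ m _ => Nat.zero_le _
    | succ n ih =>
      rw [pow_succ]
      refine (Ideal.mul_mono ih (Ideal.span_le.2 ?_)).trans (pairIdeal_mul_le x y n 1)
      rintro q (rfl | rfl) m hm
      all_goals
        rw [support_X, Finset.mem_singleton] at hm
        subst hm
        simp
  · rw [q.as_sum]
    refine Ideal.sum_mem _ fun m hm => ?_
    have h1 : (X x ^ m x * X y ^ m y : MvPolynomial ι K) ∈ Ideal.span {X x, X y} ^ n := by
      refine Ideal.pow_le_pow_right (hq m hm) ?_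
      rw [pow_add]
      exact Ideal.mul_mem_mul
        (Ideal.pow_mem_pow (Ideal.subset_span (by simp)) _)
        (Ideal.pow_mem_pow (Ideal.subset_span (by simp)) _)
    have hle : Finsupp.single x (m x) + Finsupp.single y (m y) ≤ m := by
      intro z
      simp only [Finsupp.add_apply, Finsupp.single_apply]
      split_ifs with h h' h'
      · exact absurd (h.trans h'.symm) hxy
      · simp [h]
      · simp [h']
      · simp
    rw [← tsub_add_cancel_of_le hle, ← mul_one (coeff _ q), ← monomial_mul]
    refine Ideal.mul_mem_left _ _ ?_
    rwa [X_pow_eq_monomial, X_pow_eq_monomial, monomial_mul, mul_one] at h1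

lemma mem_symbPow {G : SimpleGraph ι} {n : ℕ} {q : MvPolynomial ι K} :
    q ∈ DS.symbPow K G n ↔ ∀ m ∈ q.support, ∀ x y, G.Adj x y → n ≤ m x + m y := by
  simp only [DS.symbPow, Submodule.mem_iInf, Prod.forall]
  constructor
  · intro h m hm x y hxy
    have := h x y hxy
    rw [span_pair_pow_eq hxy.ne] at this
    exact this m hm
  · intro h x y hxy
    rw [span_pair_pow_eq hxy.ne]
    exact fun m hm => h m hm x y hxy

lemma symbPow_zero (G : SimpleGraph ι) : DS.symbPow K G 0 = ⊤ :=
  eq_top_iff.2 fun _ _ => mem_symbPow.2 fun _ _ _ _ _ => Nat.zero_le _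

lemma mem_span_range_X {q : MvPolynomial ι K} :
    q ∈ Ideal.span (Set.range (X : ι → MvPolynomial ι K)) ↔ coeff 0 q = 0 := by
  rw [← Set.image_univ, mem_ideal_span_X_image]
  constructor
  · intro h
    by_contra h0
    obtain ⟨i, -, hi⟩ := h 0 (mem_support_iff.2 h0)
    simp at hi
  · intro h m hm
    have : m ≠ 0 := by rintro rfl; exact mem_support_iff.1 hm h
    obtain ⟨i, hi⟩ := Finsupp.ne_iff.1 this
    exact ⟨i, trivial, hi⟩

lemma symbPow_le {G : SimpleGraph ι} (hE : G.edgeSet.Nonempty) {n : ℕ} (hn : 1 ≤ n) :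
    DS.symbPow K G n ≤ Ideal.span (Set.range X) := by
  intro q hq
  rw [mem_span_range_X]
  by_contra h0
  obtain ⟨e, he⟩ := hE
  induction e using Sym2.ind with
  | _ x y =>
    have := mem_symbPow.1 hq 0 (mem_support_iff.2 h0) x y he
    simp at this
    omega

end SymbolicPowers

section Multigraded

open MvPolynomial

variable {ι : Type*} [LinearOrder ι] {K : Type*} [Field K]

/-- The indicator function of `σ`, as an exponent vector. -/
noncomputable def ind (σ : Finset ι) : ι →₀ ℕ := Finsupp.indicator σ fun _ _ => 1

lemma ind_apply (σ : Finset ι) (j : ι) : ind σ j = if j ∈ σ then 1 else 0 := by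
  simp [ind, Finsupp.indicator_apply]

lemma ind_erase_add {σ : Finset ι} {j : ι} (hj : j ∈ σ) :
    ind (σ.erase j) + Finsupp.single j 1 = ind σ := by
  ext k
  simp only [Finsupp.add_apply, ind_apply, Finset.mem_erase, Finsupp.single_apply]
  by_cases h : j = k
  · subst h; simp [hj]
  · simp [h, Ne.symm h]

lemma coeff_kd_X (f : Finset ι → MvPolynomial ι K) (b : ι →₀ ℕ) (σ : Finset ι) :
    coeff (b + ind σ) (kd (X : ι → MvPolynomial ι K) f σ) =
      kd (fun _ => (1 : K)) (fun τ => coeff (b + ind τ) (f τ)) σ := by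
  rw [kd_apply, kd_apply, coeff_sum]
  refine Finset.sum_congr rfl fun j hj => ?_
  rw [smul_eq_mul, mul_assoc]
  have : (sgn (MvPolynomial ι K) j σ) = C (sgn K j σ) := by simp [sgn]
  rw [this, coeff_C_mul, ← ind_erase_add hj, ← add_assoc, add_comm _ (Finsupp.single j 1),
    coeff_X_mul, mul_one, smul_eq_mul]

lemma kd_X_monomial (h : Finset ι → K) (b : ι →₀ ℕ) (σ : Finset ι) :
    kd (X : ι → MvPolynomial ι K) (fun τ => monomial (b + ind τ) (h τ)) σ =
      monomial (b + ind σ) (kd (fun _ => (1 : K)) h σ) := by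
  rw [kd_apply, kd_apply, map_sum]
  refine Finset.sum_congr rfl fun j hj => ?_
  have : (sgn (MvPolynomial ι K) j σ) = C (sgn K j σ) := by simp [sgn]
  rw [this, smul_eq_mul, X, mul_assoc, monomial_mul, C_mul_monomial, ← ind_erase_add hj,
    add_left_comm, add_comm _ (ind _), one_mul, mul_one, smul_eq_mul]

/-- The subsets `σ` for which the `n`-th symbolic power has an element of multidegree
`b + ind σ - (1, …, 1)`. -/
def Mem (G : SimpleGraph ι) (n : ℕ) (b : ι →₀ ℕ) (σ : Finset ι) : Prop :=
  (∀ v, 1 ≤ b v + ind σ v) ∧ ∀ x y, G.Adj x y → n + 2 ≤ b x + ind σ x + (b y + ind σ y)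

variable [Fintype ι]

lemma ind_univ_le {b : ι →₀ ℕ} {σ : Finset ι} (h : ∀ v, 1 ≤ b v + ind σ v) :
    ind Finset.univ ≤ b + ind σ := fun v => by
  simpa [ind_apply Finset.univ] using h v

lemma mem_of_coeff_ne_zero {G : SimpleGraph ι} {n : ℕ} {q : MvPolynomial ι K}
    (hq : q ∈ DS.symbPow K G n) {b : ι →₀ ℕ} {σ : Finset ι}
    (h : coeff (b + ind σ) (monomial (ind Finset.univ) 1 * q) ≠ 0) : Mem G n b σ := by
  rw [coeff_monomial_mul', one_mul] at h
  split_ifs at h with hle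
  · have h1 : ∀ v, 1 ≤ b v + ind σ v := fun v => by
      simpa [ind_apply Finset.univ] using hle v
    refine ⟨h1, fun x y hxy => ?_⟩
    have := mem_symbPow.1 hq _ (mem_support_iff.2 h) x y hxy
    simp only [Finsupp.tsub_apply, Finsupp.add_apply, ind_apply Finset.univ, Finset.mem_univ,
      if_true] at this
    have := h1 x
    have := h1 y
    omega
  · exact absurd rfl h

lemma monomial_mem_symbPow {G : SimpleGraph ι} {n : ℕ} {b : ι →₀ ℕ} {σ : Finset ι}
    (h : Mem G n b σ) (c : K) :
    monomial (b + ind σ - ind Finset.univ) c ∈ DS.symbPow K G n := by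
  classical
  rw [mem_symbPow]
  intro m hm x y hxy
  rw [Finset.mem_singleton.1 (support_monomial_subset hm)]
  simp only [Finsupp.tsub_apply, Finsupp.add_apply, ind_apply Finset.univ, Finset.mem_univ,
    if_true]
  have := h.2 x y hxy
  omega

lemma van_symbPow {G : SimpleGraph ι} {n i : ℕ}
    (h : ∀ b, VanOn K Finset.univ (Mem G n b) i) :
    Van (X : ι → MvPolynomial ι K) (DS.symbPow K G n) i := by
  classical
  intro f hf
  set u : MvPolynomial ι K := monomial (ind Finset.univ) 1 with hu
  set Φ : (ι →₀ ℕ) → Finset ι → K := fun b σ => coeff (b + ind σ) (u * (f σ : MvPolynomial ι K))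
    with hΦ
  have hclosed : ∀ b σ, σ.card = i + 1 → kd (fun _ => (1 : K)) (Φ b) σ = 0 := by
    intro b σ hσ
    rw [hΦ, ← coeff_kd_X]
    have h1 := kd_comp (X : ι → MvPolynomial ι K)
      (LinearMap.lsmul _ _ u ∘ₗ (DS.symbPow K G n).subtype) f σ
    rw [hf σ hσ, map_zero] at h1
    change coeff _ (kd X (fun τ => (LinearMap.lsmul _ _ u ∘ₗ (DS.symbPow K G n).subtype) (f τ)) σ)
      = 0
    rw [h1, coeff_zero]
  have hex : ∀ b, ∃ g : Finset ι → K, (∀ σ, ¬ Mem G n b σ → g σ = 0) ∧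
      ∀ σ, σ.card = i → kd (fun _ => (1 : K)) g σ = Φ b σ := by
    intro b
    obtain ⟨g, hg, hg'⟩ := h b (Φ b)
      (fun σ _ hσ => by_contra fun h0 => hσ (mem_of_coeff_ne_zero (f σ).2 h0))
      fun σ _ hσ => hclosed b σ hσ
    exact ⟨g, fun σ => hg σ (Finset.subset_univ _), fun σ => hg' σ (Finset.subset_univ _)⟩
  choose g hg hg' using hex
  have hfin : {b | ∃ σ, Φ b σ ≠ 0}.Finite := by
    have : {b | ∃ σ, Φ b σ ≠ 0} =
        ⋃ σ : Finset ι, (fun b => b + ind σ) ⁻¹'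
          ((u * (f σ : MvPolynomial ι K)).support : Set _) := by
      ext b
      simp [hΦ]
    rw [this]
    exact Set.finite_iUnion fun σ => (Finset.finite_toSet _).preimage
      (add_left_injective (ind σ)).injOn
  set B := hfin.toFinset with hB
  let F : Finset ι → MvPolynomial ι K := fun σ =>
    ∑ b ∈ B, if Mem G n b σ then monomial (b + ind σ - ind Finset.univ) (g b σ) else 0
  have hF : ∀ σ, F σ ∈ DS.symbPow K G n := fun σ => Ideal.sum_mem _ fun b _ => by
    split_ifs with hb
    exacts [monomial_mem_symbPow hb _, zero_mem _]
  have huF : ∀ σ, u * F σ = ∑ b ∈ B, monomial (b + ind σ) (g b σ) := by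
    intro σ
    rw [Finset.mul_sum]
    refine Finset.sum_congr rfl fun b _ => ?_
    split_ifs with hb
    · rw [hu, monomial_mul, one_mul, add_tsub_cancel_of_le (ind_univ_le hb.1)]
    · rw [hg b σ hb, mul_zero, map_zero]
  refine ⟨fun σ => ⟨F σ, hF σ⟩, fun σ hσ => ?_⟩
  have hu0 : u ≠ 0 := by simp [hu]
  refine Subtype.ext (mul_left_cancel₀ hu0 ?_)
  have h1 := kd_comp (X : ι → MvPolynomial ι K)
    (LinearMap.lsmul _ _ u ∘ₗ (DS.symbPow K G n).subtype) (fun σ => ⟨F σ, hF σ⟩) σ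
  refine h1.symm.trans ?_
  have h2 : (fun τ => (LinearMap.lsmul _ _ u ∘ₗ (DS.symbPow K G n).subtype) ⟨F τ, hF τ⟩) =
      ∑ b ∈ B, fun τ => monomial (b + ind τ) (g b τ) := by
    ext1 τ
    rw [Finset.sum_apply]
    exact huF τ
  rw [h2, map_sum, Finset.sum_apply]
  simp only [kd_X_monomial]
  rw [Finset.sum_congr rfl fun b _ => by rw [hg' b σ hσ]]
  ext m
  rw [coeff_sum]
  simp only [coeff_monomial]
  by_cases hm : ∃ b, b + ind σ = m
  · obtain ⟨b, rfl⟩ := hm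
    simp only [add_left_inj, Finset.sum_ite_eq']
    split_ifs with hb
    · rfl
    · by_contra h0
      exact hb (hfin.mem_toFinset.2 ⟨σ, Ne.symm h0⟩)
  · rw [Finset.sum_eq_zero fun b _ => if_neg fun hb => hm ⟨b, hb⟩, hu, coeff_monomial_mul', if_neg]
    intro hle
    refine hm ⟨m - ind σ, tsub_add_cancel_of_le (le_trans (fun v => ?_) hle)⟩
    rw [ind_apply, ind_apply]
    split_ifs <;> simp_all

end Multigraded

end Koszul

namespace Koszul

section Certificates

/-- There is a weight function which is at least `n - 1` on every edge, and such that the edges of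
weight `n - 1` form a perfect matching. -/
def Cert {ι : Type*} (G : SimpleGraph ι) (n : ℕ) : Prop :=
  ∃ a : ι → ℕ, (∀ x y, G.Adj x y → n ≤ a x + a y + 1) ∧
    ∀ x, ∃! y, G.Adj x y ∧ a x + a y + 1 = n

lemma not_cert_zero {ι : Type*} {G : SimpleGraph ι} [Nonempty ι] : ¬ Cert G 0 := by
  rintro ⟨a, -, h⟩
  obtain ⟨y, hy, -⟩ := h (Classical.arbitrary ι)
  omega

lemma Van.of_linearEquiv {ι : Type*} [LinearOrder ι] {R M N : Type*} [CommRing R]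
    [AddCommGroup M] [Module R M]
    [AddCommGroup N] [Module R N] (x : ι → R) (e : M ≃ₗ[R] N) {i : ℕ} (h : Van x M i) :
    Van x N i := by
  intro f hf
  obtain ⟨g, hg⟩ := h (fun σ => e.symm (f σ)) fun σ hσ => by
    rw [← LinearEquiv.coe_coe, kd_comp, hf σ hσ, map_zero]
  refine ⟨fun σ => e (g σ), fun σ hσ => ?_⟩
  rw [← LinearEquiv.coe_coe, kd_comp, hg σ hσ]
  simp

variable {ι : Type*} [Fintype ι]

/-- The edges of `G` on which `b` has weight `n + 1`. -/
def tightGraph (G : SimpleGraph ι) (n : ℕ) (b : ι →₀ ℕ) : SimpleGraph ι where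
  Adj x y := G.Adj x y ∧ b x + b y = n + 1
  symm := ⟨fun _ _ h => ⟨h.1.symm, by rw [add_comm]; exact h.2⟩⟩
  loopless := ⟨fun _ h => h.1.ne rfl⟩

open Classical in
/-- The vertices lying in every `σ` with `Mem G n b σ`. -/
noncomputable def forced (G : SimpleGraph ι) (n : ℕ) (b : ι →₀ ℕ) : Finset ι :=
  Finset.univ.filter fun v => b v = 0 ∨ ∃ y, G.Adj v y ∧ b v + b y ≤ n

lemma mem_forced {G : SimpleGraph ι} {n : ℕ} {b : ι →₀ ℕ} {v : ι} :
    v ∈ forced G n b ↔ b v = 0 ∨ ∃ y, G.Adj v y ∧ b v + b y ≤ n := by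
  simp [forced]

variable [LinearOrder ι] {K : Type*} [Field K]

lemma mem_iff_cov {G : SimpleGraph ι} {n : ℕ} {b : ι →₀ ℕ}
    (h : ∀ x y, G.Adj x y → n ≤ b x + b y) (σ : Finset ι) :
    Cov (tightGraph G n b) (forced G n b) Finset.univ σ ↔ Mem G n b σ := by
  simp only [Mem, Cov, ind_apply]
  constructor
  · rintro ⟨h1, h2⟩
    refine ⟨fun v => ?_, fun x y hxy => ?_⟩
    · by_cases hv : b v = 0
      · rw [if_pos (h1 (mem_forced.2 (Or.inl hv)))]; omega
      · omega
    · have h3 := h x y hxy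
      by_cases h4 : b x + b y ≤ n
      · rw [if_pos (h1 (mem_forced.2 (Or.inr ⟨y, hxy, h4⟩))),
          if_pos (h1 (mem_forced.2 (Or.inr ⟨x, hxy.symm, by omega⟩)))]
        omega
      · by_cases h5 : b x + b y = n + 1
        · rcases h2 x (Finset.mem_univ _) y (Finset.mem_univ _) ⟨hxy, h5⟩ with h6 | h6 <;>
            rw [if_pos h6] <;> omega
        · omega
  · rintro ⟨h1, h2⟩
    refine ⟨fun v hv => ?_, fun x _ y _ hxy => ?_⟩
    · by_contra hvσ
      rcases mem_forced.1 hv with h3 | ⟨y, hy, h3⟩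
      · have := h1 v
        rw [if_neg hvσ] at this
        omega
      · have := h2 v y hy
        rw [if_neg hvσ] at this
        split_ifs at this <;> omega
    · by_contra! h3
      have h4 := h2 x y hxy.1
      have h5 := hxy.2
      rw [if_neg h3.1, if_neg h3.2] at h4
      omega

lemma vanOn_mem_of_cov {G : SimpleGraph ι} {n i : ℕ} {b : ι →₀ ℕ}
    (h : VanOn K Finset.univ (Cov (tightGraph G n b) (forced G n b) Finset.univ) i) :
    VanOn K Finset.univ (Mem G n b) i := by
  by_cases hb : ∀ x y, G.Adj x y → n ≤ b x + b y
  · exact h.congr fun σ _ => mem_iff_cov hb σ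
  · push Not at hb
    obtain ⟨x, y, hxy, hlt⟩ := hb
    refine VanOn.of_forall_not (fun σ _ hσ => ?_) i
    have := hσ.2 x y hxy
    rw [ind_apply, ind_apply] at this
    split_ifs at this <;> omega

lemma van_symbPow_of_lt {G : SimpleGraph ι} {n i : ℕ} (hi : 2 * i < Fintype.card ι) :
    Van (MvPolynomial.X : ι → MvPolynomial ι K) (DS.symbPow K G n) i :=
  van_symbPow fun b => vanOn_mem_of_cov
    (vanOn_cov _ _ _ _ (Finset.subset_univ _) (by rw [Finset.card_univ]; omega))

lemma van_symbPow_of_not_cert {G : SimpleGraph ι} {n i : ℕ} (hi : 2 * i = Fintype.card ι)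
    (hn : ¬ Cert G n) :
    Van (MvPolynomial.X : ι → MvPolynomial ι K) (DS.symbPow K G n) i := by
  refine van_symbPow fun b => vanOn_mem_of_cov ?_
  by_contra h
  obtain ⟨hS, hex⟩ := existsUnique_adj_of_not_vanOn _ hi h
  have hb : ∀ v, 1 ≤ b v ∧ ∀ y, G.Adj v y → n + 1 ≤ b v + b y := fun v => by
    have hv : v ∉ forced G n b := by simp [hS]
    rw [mem_forced] at hv
    push Not at hv
    exact ⟨Nat.one_le_iff_ne_zero.2 hv.1, hv.2⟩
  refine hn ⟨fun v => b v - 1, fun x y hxy => ?_, fun x => ?_⟩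
  · have := (hb x).2 y hxy
    dsimp only
    omega
  · obtain ⟨y, hy, huniq⟩ := hex x
    dsimp only
    refine ⟨y, ⟨hy.1, ?_⟩, fun z hz => huniq z ⟨hz.1, ?_⟩⟩
    · have := hy.2
      have := (hb x).1
      have := (hb y).1
      omega
    · have := hz.2
      have := (hb x).1
      have := (hb z).1
      omega

lemma van_mvPolynomial [Nonempty ι] {i : ℕ} (hi : 2 * i ≤ Fintype.card ι) :
    Van (MvPolynomial.X : ι → MvPolynomial ι K) (MvPolynomial ι K) i := by
  have h : Van (MvPolynomial.X : ι → MvPolynomial ι K) (DS.symbPow K (⊥ : SimpleGraph ι) 0) i := by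
    rcases hi.lt_or_eq with h | h
    exacts [van_symbPow_of_lt h, van_symbPow_of_not_cert h not_cert_zero]
  rw [symbPow_zero] at h
  exact h.of_linearEquiv _ Submodule.topEquiv

lemma van_quotient {G : SimpleGraph ι} [Nonempty ι] {n i : ℕ} (hi : 2 * (i + 1) ≤ Fintype.card ι)
    (hn : 2 * (i + 1) = Fintype.card ι → ¬ Cert G n) :
    Van (MvPolynomial.X : ι → MvPolynomial ι K) (MvPolynomial ι K ⧸ DS.symbPow K G n) i := by
  refine Van.quotient _ (φ := (DS.symbPow K G n).subtype) (ψ := (DS.symbPow K G n).mkQ)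
    (Submodule.subtype_injective _) (Submodule.mkQ_surjective _) ?_
    (van_mvPolynomial (by omega)) ?_
  · rw [LinearMap.exact_iff, Submodule.ker_mkQ, Submodule.range_subtype]
  · rcases hi.lt_or_eq with h | h
    exacts [van_symbPow_of_lt h, van_symbPow_of_not_cert h (hn h)]

end Certificates

section Depth

open MvPolynomial

variable {ι : Type*} {K : Type*} [Field K]

lemma smul_top_quotient_ne_top {I J : Ideal (MvPolynomial ι K)}
    (hI : I ≤ Ideal.span (Set.range X)) (hJ : J ≤ Ideal.span (Set.range X)) :
    J • (⊤ : Submodule (MvPolynomial ι K) (MvPolynomial ι K ⧸ I)) ≠ ⊤ := by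
  intro h
  have h1 : (⊤ : Submodule (MvPolynomial ι K) (MvPolynomial ι K ⧸ I)) =
      Submodule.map I.mkQ ⊤ := by
    rw [Submodule.map_top, Submodule.range_mkQ]
  rw [h1, ← Submodule.map_smul''] at h
  have h2 : (1 : MvPolynomial ι K) ∈ Submodule.comap I.mkQ (Submodule.map I.mkQ (J • ⊤)) := by
    rw [h]; exact ⟨1, trivial, rfl⟩
  rw [Submodule.comap_map_mkQ] at h2
  have h3 : I ⊔ J • ⊤ ≤ Ideal.span (Set.range X) := by
    refine sup_le hI ?_
    rw [smul_eq_mul, Ideal.mul_top]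
    exact hJ
  have h4 := mem_span_range_X.1 (h3 h2)
  simp at h4

lemma depthQ_spec [LinearOrder ι] [Fintype ι] {I : Ideal (MvPolynomial ι K)}
    (hI : I ≤ Ideal.span (Set.range X)) :
    (∀ d, (∀ i < d, Van (X : ι → MvPolynomial ι K) (MvPolynomial ι K ⧸ I) i) → d ≤ DS.depthQ K I) ∧
      ∀ i < DS.depthQ K I, Van (X : ι → MvPolynomial ι K) (MvPolynomial ι K ⧸ I) i := by
  set S := {n | ∃ rs : List (MvPolynomial ι K), rs.length = n ∧
    (∀ f ∈ rs, f ∈ Ideal.span (Set.range (X : ι → MvPolynomial ι K))) ∧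
    RingTheory.Sequence.IsRegular (MvPolynomial ι K ⧸ I) rs} with hS
  have hmem : ∀ d, (∀ i < d, Van (X : ι → MvPolynomial ι K) (MvPolynomial ι K ⧸ I) i) → d ∈ S := by
    intro d hd
    obtain ⟨rs, hlen, hrs, hreg⟩ := exists_isWeaklyRegular X d _ hd
    exact ⟨rs, hlen, hrs, hreg, (smul_top_quotient_ne_top hI (Ideal.span_le.2 hrs)).symm⟩
  have hvan : ∀ d ∈ S, ∀ i < d, Van (X : ι → MvPolynomial ι K) (MvPolynomial ι K ⧸ I) i := by
    rintro d ⟨rs, rfl, hrs, hreg⟩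
    exact van_of_isWeaklyRegular X rs _ hrs hreg.toIsWeaklyRegular
  have hbdd : BddAbove S := ⟨Fintype.card ι, fun d hd => by
    by_contra! h
    exact not_van_card X (smul_top_quotient_ne_top hI le_rfl) (hvan d hd _ h)⟩
  exact ⟨fun d hd => le_csSup hbdd (hmem d hd),
    hvan _ (Nat.sSup_mem ⟨0, hmem 0 fun i hi => absurd hi (Nat.not_lt_zero i)⟩ hbdd)⟩

end Depth

end Koszul

namespace Koszul

section Cocycle

variable {ι : Type*} [LinearOrder ι] {K : Type*} [CommRing K]

/-- Exterior multiplication by the `j`-th basis vector. -/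
def wedge (K : Type*) [CommRing K] (j : ι) : (Finset ι → K) →ₗ[K] (Finset ι → K) where
  toFun f σ := if j ∈ σ then sgn K j σ * f (σ.erase j) else 0
  map_add' f g := by ext σ; simp only [Pi.add_apply]; split_ifs <;> ring
  map_smul' c f := by
    ext σ
    simp only [Pi.smul_apply, RingHom.id_apply, smul_eq_mul]
    split_ifs <;> ring

lemma wedge_of_mem {j : ι} {σ : Finset ι} (h : j ∈ σ) (f : Finset ι → K) :
    wedge K j f σ = sgn K j σ * f (σ.erase j) := if_pos h

lemma wedge_of_notMem {j : ι} {σ : Finset ι} (h : j ∉ σ) (f : Finset ι → K) :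
    wedge K j f σ = 0 := if_neg h

lemma wedge_wedge_self (j : ι) (f : Finset ι → K) : wedge K j (wedge K j f) = 0 := by
  funext σ
  by_cases h : j ∈ σ
  · rw [wedge_of_mem h, wedge_of_notMem (Finset.notMem_erase _ _), mul_zero, Pi.zero_apply]
  · rw [wedge_of_notMem h, Pi.zero_apply]

lemma wedge_wedge (j k : ι) (f : Finset ι → K) :
    wedge K j (wedge K k f) = - wedge K k (wedge K j f) := by
  by_cases hjk : j = k
  · subst hjk
    rw [wedge_wedge_self, neg_zero]
  funext σ
  rw [Pi.neg_apply]
  by_cases hj : j ∈ σ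
  · by_cases hk : k ∈ σ
    · rw [wedge_of_mem hj, wedge_of_mem hk, wedge_of_mem (Finset.mem_erase.2 ⟨Ne.symm hjk, hk⟩),
        wedge_of_mem (Finset.mem_erase.2 ⟨hjk, hj⟩)]
      have h := sgn_swap (R := K) (Finset.mem_erase.2 ⟨hjk, hj⟩) (Finset.notMem_erase k σ)
      rw [Finset.insert_erase hk, Finset.erase_right_comm, sgn_erase_self, sgn_erase_self] at h
      rw [Finset.erase_right_comm (a := k)]
      linear_combination f ((σ.erase j).erase k) * h
    · rw [wedge_of_mem hj, wedge_of_notMem hk,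
        wedge_of_notMem fun h => hk (Finset.mem_of_mem_erase h),
        mul_zero, neg_zero]
  · by_cases hk : k ∈ σ
    · rw [wedge_of_mem hk, wedge_of_notMem hj,
        wedge_of_notMem fun h => hj (Finset.mem_of_mem_erase h),
        mul_zero, neg_zero]
    · rw [wedge_of_notMem hk, wedge_of_notMem hj, neg_zero]

lemma kd_one_eq_sum [Fintype ι] (f : Finset ι → K) :
    kd (fun _ => (1 : K)) f = ∑ j, wedge K j f := by
  funext σ
  rw [kd_apply, Finset.sum_apply, ← Finset.sum_subset (Finset.subset_univ σ)]
  · exact Finset.sum_congr rfl fun j hj => by rw [wedge_of_mem hj, mul_one, smul_eq_mul]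
  · exact fun j _ hj => wedge_of_notMem hj f

variable {t : ℕ} (u v : Fin t → ι)

/-- Exterior multiplication by the sum of the two basis vectors of the `i`-th pair. -/
def wedgePair (K : Type*) [CommRing K] (i : Fin t) : (Finset ι → K) →ₗ[K] (Finset ι → K) :=
  wedge K (u i) + wedge K (v i)

lemma wedgePair_apply (i : Fin t) (f : Finset ι → K) (σ : Finset ι) :
    wedgePair u v K i f σ = wedge K (u i) f σ + wedge K (v i) f σ := rfl

/-- The exterior product of the sums of pairs indexed by the list `l`. -/
def pairProd (K : Type*) [CommRing K] (l : List (Fin t)) : Finset ι → K :=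
  l.foldr (fun i f => wedgePair u v K i f) (Pi.single ∅ 1)

lemma pairProd_cons (i : Fin t) (l : List (Fin t)) :
    pairProd u v K (i :: l) = wedgePair u v K i (pairProd u v K l) := rfl

lemma wedgePair_wedgePair (i j : Fin t) (f : Finset ι → K) :
    wedgePair u v K i (wedgePair u v K j f) = - wedgePair u v K j (wedgePair u v K i f) := by
  simp only [wedgePair, LinearMap.add_apply, map_add]
  rw [wedge_wedge (u i) (u j), wedge_wedge (u i) (v j), wedge_wedge (v i) (u j),
    wedge_wedge (v i) (v j)]
  abel

lemma wedgePair_wedgePair_self (i : Fin t) (f : Finset ι → K) :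
    wedgePair u v K i (wedgePair u v K i f) = 0 := by
  simp only [wedgePair, LinearMap.add_apply, map_add]
  rw [wedge_wedge_self, wedge_wedge_self, wedge_wedge (u i) (v i)]
  abel

lemma wedgePair_pairProd {i : Fin t} {l : List (Fin t)} (hi : i ∈ l) :
    wedgePair u v K i (pairProd u v K l) = 0 := by
  induction l with
  | nil => simp at hi
  | cons j l ih =>
    rw [pairProd_cons]
    by_cases hij : i = j
    · rw [hij, wedgePair_wedgePair_self]
    · rw [wedgePair_wedgePair, ih ((List.mem_cons.1 hi).resolve_left hij), map_zero, neg_zero]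

lemma mem_of_pairProd_ne_zero {l : List (Fin t)} {σ : Finset ι} (h : pairProd u v K l σ ≠ 0) :
    ∀ i ∈ l, u i ∈ σ ∨ v i ∈ σ := by
  induction l generalizing σ with
  | nil => simp
  | cons j l ih =>
    have key : ∀ x ∈ σ, pairProd u v K l (σ.erase x) ≠ 0 → ∀ i ∈ l, u i ∈ σ ∨ v i ∈ σ :=
      fun x _ hx i hi => (ih hx i hi).imp Finset.mem_of_mem_erase Finset.mem_of_mem_erase
    rw [pairProd_cons, wedgePair_apply] at h
    intro i hi
    by_cases hu : u j ∈ σ ∧ pairProd u v K l (σ.erase (u j)) ≠ 0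
    · rcases List.mem_cons.1 hi with rfl | hi
      exacts [Or.inl hu.1, key _ hu.1 hu.2 i hi]
    by_cases hv : v j ∈ σ ∧ pairProd u v K l (σ.erase (v j)) ≠ 0
    · rcases List.mem_cons.1 hi with rfl | hi
      exacts [Or.inr hv.1, key _ hv.1 hv.2 i hi]
    have hz : ∀ x, ¬ (x ∈ σ ∧ pairProd u v K l (σ.erase x) ≠ 0) →
        wedge K x (pairProd u v K l) σ = 0 := by
      intro x hx
      by_cases hxσ : x ∈ σ
      · rw [wedge_of_mem hxσ, not_not.1 (not_and.1 hx hxσ), mul_zero]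
      · exact wedge_of_notMem hxσ _
    rw [hz _ hu, hz _ hv, add_zero] at h
    exact absurd rfl h

lemma pairProd_image_ne_zero [IsDomain K] (huv : Function.Injective (Sum.elim u v))
    {l : List (Fin t)} (hl : l.Nodup) :
    pairProd u v K l (l.toFinset.image u) ≠ 0 := by
  have hu : Function.Injective u := fun i j h => Sum.inl_injective (huv h)
  have hne : ∀ i j, u i ≠ v j := fun i j h => Sum.inl_ne_inr (huv (a₁ := .inl i) (a₂ := .inr j) h)
  induction l with
  | nil => simp [pairProd]
  | cons j l ih =>
    rw [List.nodup_cons] at hl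
    have hj : u j ∉ l.toFinset.image u := by
      rw [Finset.mem_image]
      rintro ⟨k, hk, hkj⟩
      exact hl.1 (hu hkj ▸ List.mem_toFinset.1 hk)
    rw [pairProd_cons, wedgePair_apply, List.toFinset_cons, Finset.image_insert,
      wedge_of_mem (Finset.mem_insert_self _ _), Finset.erase_insert hj, wedge_of_notMem, add_zero]
    · exact mul_ne_zero (sgn_ne_zero _ _) (ih hl.2)
    · rw [← Finset.image_insert, Finset.mem_image]
      rintro ⟨k, -, hk⟩
      exact hne k j hk

lemma kd_pairProd [Fintype ι] (huv : Function.Bijective (Sum.elim u v)) :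
    kd (fun _ => (1 : K)) (pairProd u v K (List.finRange t)) = 0 := by
  rw [kd_one_eq_sum, ← (Equiv.ofBijective _ huv).sum_comp, Fintype.sum_sum_type,
    ← Finset.sum_add_distrib]
  exact Finset.sum_eq_zero fun i _ => wedgePair_pairProd u v (List.mem_finRange i)

end Cocycle

section NonVanishing

open MvPolynomial

variable {ι : Type*} [LinearOrder ι] [Fintype ι] {K : Type*} [Field K]

lemma not_van_symbPow {G : SimpleGraph ι} {n t : ℕ} {u v : Fin t → ι}
    (huv : Function.Bijective (Sum.elim u v)) (b : ι →₀ ℕ) (hadj : ∀ i, G.Adj (u i) (v i))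
    (htight : ∀ i, b (u i) + b (v i) + 1 = n)
    (hedge : ∀ x y, G.Adj x y → n ≤ b x + b y ∨ ∃ i, x = u i ∧ y = v i ∨ x = v i ∧ y = u i) :
    ¬ Van (X : ι → MvPolynomial ι K) (DS.symbPow K G n) t := by
  classical
  intro hvan
  set c := pairProd u v K (List.finRange t) with hc
  have hu : Function.Injective u := fun i j h => Sum.inl_injective (huv.1 h)
  have hne : ∀ i j, u i ≠ v j := fun i j h =>
    Sum.inl_ne_inr (huv.1 (a₁ := .inl i) (a₂ := .inr j) h)
  have hmem : ∀ σ, monomial (b + ind σ) (c σ) ∈ DS.symbPow K G n := by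
    intro σ
    rw [mem_symbPow]
    intro m hm x y hxy
    have hcσ : c σ ≠ 0 := by
      intro h
      rw [h, map_zero] at hm
      simp at hm
    rw [Finset.mem_singleton.1 (support_monomial_subset hm), Finsupp.add_apply, Finsupp.add_apply]
    rcases hedge x y hxy with h | ⟨i, h⟩
    · omega
    · have h1 := htight i
      have h2 : 1 ≤ ind σ (u i) + ind σ (v i) := by
        rw [ind_apply, ind_apply]
        rcases mem_of_pairProd_ne_zero u v hcσ i (List.mem_finRange i) with h | h <;>
          rw [if_pos h] <;> omega
      rcases h with ⟨rfl, rfl⟩ | ⟨rfl, rfl⟩ <;> omega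
  obtain ⟨g, hg⟩ := hvan (fun σ => ⟨_, hmem σ⟩) fun σ _ => by
    apply Subtype.ext
    rw [← Submodule.subtype_apply, ← kd_comp]
    simp only [Submodule.subtype_apply]
    rw [kd_X_monomial, hc, kd_pairProd u v huv]
    simp
  set σ₀ := (List.finRange t).toFinset.image u with hσ₀
  have h0 : c σ₀ ≠ 0 := pairProd_image_ne_zero u v huv.1 (List.nodup_finRange t)
  have h1 := congrArg Subtype.val (hg σ₀ (by
    rw [hσ₀, Finset.card_image_of_injective _ hu,
      List.toFinset_card_of_nodup (List.nodup_finRange t), List.length_finRange]))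
  rw [← Submodule.subtype_apply, ← kd_comp] at h1
  simp only [Submodule.subtype_apply] at h1
  have h2 := congrArg (coeff (b + ind σ₀)) h1
  rw [coeff_kd_X, coeff_monomial, if_pos rfl, kd_apply] at h2
  refine h0 (h2.symm.trans (Finset.sum_eq_zero fun j hj => ?_))
  obtain ⟨i, -, rfl⟩ := Finset.mem_image.1 hj
  by_contra h3
  have h4 := mem_symbPow.1 (g (σ₀.erase (u i))).2 _
    (mem_support_iff.2 (right_ne_zero_of_smul h3)) _ _ (hadj i)
  have h5 := htight i
  have h6 : v i ∉ σ₀.erase (u i) := fun h => by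
    obtain ⟨k, -, hk⟩ := Finset.mem_image.1 (Finset.mem_of_mem_erase h)
    exact hne k i hk
  rw [Finsupp.add_apply, Finsupp.add_apply, ind_apply, ind_apply,
    if_neg (Finset.notMem_erase _ _), if_neg h6] at h4
  omega

end NonVanishing

end Koszul

namespace DS

section Matchings

variable {V : Type*} {G : SimpleGraph V} {t : ℕ} {u v : Fin t → V}

lemma IsMatchingPair.fst_ne_snd (h : IsMatchingPair G u v) (i j : Fin t) : u i ≠ v j := fun hij =>
  Sum.inl_ne_inr (h.1 (a₁ := .inl i) (a₂ := .inr j) hij)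

lemma IsMatchingPair.fst_injective (h : IsMatchingPair G u v) : Function.Injective u :=
  fun _ _ hij => Sum.inl_injective (h.1 hij)

lemma IsMatchingPair.snd_injective (h : IsMatchingPair G u v) : Function.Injective v :=
  fun _ _ hij => Sum.inr_injective (h.1 hij)

lemma IsMatchingPair.mk_mem_omEdges_iff (h : IsMatchingPair G u v) (i j : Fin t) :
    s(u i, v j) ∈ omEdges u v ↔ i = j := by
  constructor
  · rintro ⟨k, hk⟩
    rcases Sym2.eq_iff.1 hk with ⟨h1, h2⟩ | ⟨h1, -⟩
    · exact (h.fst_injective h1).trans (h.snd_injective h2).symm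
    · exact absurd h1 (h.fst_ne_snd _ _)
  · rintro rfl
    exact ⟨i, rfl⟩

lemma IsMatchingPair.snd_snd_notMem_omEdges (h : IsMatchingPair G u v) (i j : Fin t) :
    s(v i, v j) ∉ omEdges u v := by
  rintro ⟨k, hk⟩
  rcases Sym2.eq_iff.1 hk with ⟨h1, -⟩ | ⟨-, h1⟩
  exacts [h.fst_ne_snd _ _ h1.symm, h.fst_ne_snd _ _ h1.symm]

lemma isAlt_iff {M : Set (Sym2 V)} {a b : V} {w : G.Walk a b} :
    IsAlt M w ↔ List.IsChain (fun e f => (e ∈ M ↔ f ∉ M)) w.edges := Iff.rfl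

lemma exists_eq_or_eq (hs : Function.Surjective (Sum.elim u v)) (x : V) :
    ∃ i, x = u i ∨ x = v i := by
  obtain ⟨i | i, rfl⟩ := hs x
  exacts [⟨i, Or.inl rfl⟩, ⟨i, Or.inr rfl⟩]

/-- A weight function equal to `n - 1` on the edges of the matching and at least `n` on the other
edges. -/
def IsPotential (G : SimpleGraph V) (u v : Fin t → V) (n : ℕ) (a : V → ℕ) : Prop :=
  (∀ i, a (u i) + a (v i) + 1 = n) ∧ ∀ x y, G.Adj x y → s(x, y) ∉ omEdges u v → n ≤ a x + a y

lemma IsPotential.add_eq {n : ℕ} {a : V → ℕ} (h : IsPotential G u v n a) {x y : V}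
    (hxy : s(x, y) ∈ omEdges u v) : a x + a y + 1 = n := by
  obtain ⟨i, hi⟩ := hxy
  have := h.1 i
  rcases Sym2.eq_iff.1 hi with ⟨rfl, rfl⟩ | ⟨rfl, rfl⟩ <;> omega

lemma IsPotential.lt (hs : Function.Surjective (Sum.elim u v)) {n : ℕ} {a : V → ℕ}
    (h : IsPotential G u v n a) (x : V) : a x < n := by
  obtain ⟨i, rfl | rfl⟩ := exists_eq_or_eq hs x <;>
  · have := h.1 i
    omega

lemma IsPotential.length_aux (hs : Function.Surjective (Sum.elim u v)) {n : ℕ} {a : V → ℕ}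
    (h : IsPotential G u v n a) {x y : V} (w : G.Walk x y) (hw : IsAlt (omEdges u v) w) :
    ((∀ e ∈ w.edges.head?, e ∈ omEdges u v) → w.length + 2 * a x + 1 ≤ 2 * n) ∧
      ((∀ e ∈ w.edges.head?, e ∉ omEdges u v) → w.length ≤ 2 * a x) := by
  induction w with
  | nil =>
    rename_i x
    have := h.lt hs x
    exact ⟨fun _ => by simp only [SimpleGraph.Walk.length_nil]; omega, fun _ => Nat.zero_le _⟩
  | cons hxz w ih =>
    rename_i x z y
    rw [isAlt_iff, SimpleGraph.Walk.edges_cons, List.isChain_cons] at hw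
    obtain ⟨ih1, ih2⟩ := ih hw.2
    simp only [SimpleGraph.Walk.edges_cons, List.head?_cons, Option.mem_some_iff, forall_eq',
      SimpleGraph.Walk.length_cons]
    refine ⟨fun he => ?_, fun he => ?_⟩
    · have h1 := ih2 fun e hew => (hw.1 e hew).1 he
      have h2 := h.add_eq he
      omega
    · have h1 := ih1 fun e hew => by
        by_contra h2
        exact he ((hw.1 e hew).2 h2)
      have h2 := h.2 _ _ hxz he
      omega

lemma IsPotential.length_lt (hs : Function.Surjective (Sum.elim u v)) {n : ℕ} {a : V → ℕ}
    (h : IsPotential G u v n a) {x y : V} (w : G.Walk x y) (hw : IsAlt (omEdges u v) w) :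
    w.length + 1 ≤ 2 * n := by
  obtain ⟨h1, h2⟩ := h.length_aux hs w hw
  have h3 := h.lt hs x
  cases hd : w.edges.head? with
  | none =>
    have := h2 (by simp [hd])
    omega
  | some e =>
    by_cases he : e ∈ omEdges u v
    · have := h1 (by simpa [hd] using he)
      omega
    · have := h2 (by simpa [hd] using he)
      omega

lemma IsPotential.ellM_lt (hs : Function.Surjective (Sum.elim u v)) {n : ℕ} {a : V → ℕ}
    (h : IsPotential G u v n a) (hn : 1 ≤ n) : ellM G (omEdges u v) + 1 ≤ 2 * n := by
  have : ellM G (omEdges u v) ≤ 2 * n - 1 := csSup_le' (by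
    rintro _ ⟨x, y, w, hw, rfl⟩
    have := h.length_lt hs w hw
    omega)
  omega

open Classical in
lemma IsOrderedMatching.exists_isPotential (hM : IsOrderedMatching G u v)
    (hs : Function.Surjective (Sum.elim u v)) : ∃ n a, IsPotential G u v n a := by
  have hex := exists_eq_or_eq hs
  choose f hf using hex
  let a : V → ℕ := fun x => if x = u (f x) then t - f x else t + 1 + f x
  have hau : ∀ i, a (u i) = t - i := fun i => by
    have : f (u i) = i := by
      rcases hf (u i) with h | h
      exacts [(hM.1.fst_injective h).symm, absurd h (hM.1.fst_ne_snd _ _)]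
    simp only [a, this, if_true]
  have hav : ∀ i, a (v i) = t + 1 + i := fun i => by
    have : f (v i) = i := by
      rcases hf (v i) with h | h
      exacts [absurd h.symm (hM.1.fst_ne_snd _ _), (hM.1.snd_injective h).symm]
    simp only [a, this, if_neg (hM.1.fst_ne_snd i i).symm]
  refine ⟨2 * t + 2, a, fun i => ?_, fun x y hxy he => ?_⟩
  · rw [hau, hav]; omega
  · have key : ∀ i j, G.Adj (u i) (v j) → s(u i, v j) ∉ omEdges u v →
        2 * t + 2 ≤ a (u i) + a (v j) := fun i j hij hne => by
      rw [hM.1.mk_mem_omEdges_iff] at hne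
      have h1 := lt_of_le_of_ne (hM.2.2 i j hij) hne
      have h2 : (i : ℕ) < j := h1
      rw [hau, hav]
      omega
    obtain ⟨i, rfl | rfl⟩ := exists_eq_or_eq hs x <;> obtain ⟨j, rfl | rfl⟩ := exists_eq_or_eq hs y
    · exact absurd hxy (hM.2.1 i j)
    · exact key i j hxy he
    · rw [add_comm (a _)]
      exact key j i hxy.symm (by rwa [Sym2.eq_swap])
    · rw [hav, hav]; omega

lemma IsOrderedMatching.bddAbove_length (hM : IsOrderedMatching G u v)
    (hs : Function.Surjective (Sum.elim u v)) :
    BddAbove {n | ∃ (a b : V) (w : G.Walk a b), IsAlt (omEdges u v) w ∧ w.length = n} := by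
  obtain ⟨n, a, ha⟩ := hM.exists_isPotential hs
  refine ⟨2 * n, ?_⟩
  rintro _ ⟨x, y, w, hw, rfl⟩
  have := ha.length_lt hs w hw
  omega

/-- There is an alternating walk of length `2 * k + 1` starting at `v i` with a matching edge. -/
def HasAltWalk (G : SimpleGraph V) (u v : Fin t → V) (i : Fin t) (k : ℕ) : Prop :=
  ∃ (b : V) (w : G.Walk (v i) b), IsAlt (omEdges u v) w ∧
    (∀ e ∈ w.edges.head?, e ∈ omEdges u v) ∧ w.length = 2 * k + 1

lemma IsMatchingPair.hasAltWalk_zero (hM : IsMatchingPair G u v) (i : Fin t) :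
    HasAltWalk G u v i 0 := by
  refine ⟨u i, .cons (hM.2 i).symm .nil, ?_, ?_, rfl⟩
  · simp [isAlt_iff]
  · simpa [Sym2.eq_swap] using (hM.mk_mem_omEdges_iff i i).2 rfl

lemma HasAltWalk.succ (hM : IsMatchingPair G u v) {i j : Fin t} {k : ℕ} (h : HasAltWalk G u v j k)
    (hij : G.Adj (u i) (v j)) (hne : i ≠ j) : HasAltWalk G u v i (k + 1) := by
  obtain ⟨b, w, hw, hhead, hlen⟩ := h
  have h1 : s(v i, u i) ∈ omEdges u v := by
    rw [Sym2.eq_swap]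
    exact (hM.mk_mem_omEdges_iff i i).2 rfl
  have h2 : s(u i, v j) ∉ omEdges u v := fun h => hne ((hM.mk_mem_omEdges_iff i j).1 h)
  refine ⟨b, .cons (hM.2 i).symm (.cons hij w), ?_, ?_, ?_⟩
  · rw [isAlt_iff, SimpleGraph.Walk.edges_cons, SimpleGraph.Walk.edges_cons,
      List.isChain_cons, List.isChain_cons]
    refine ⟨?_, fun e he => ?_, hw⟩
    · simp [h1, h2]
    · simp [h2, hhead e he]
  · simpa using h1
  · simp only [SimpleGraph.Walk.length_cons, hlen]
    omega

lemma HasAltWalk.exists_walk (hM : IsMatchingPair G u v) {i j : Fin t} {k l : ℕ}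
    (hi : HasAltWalk G u v i k) (hj : HasAltWalk G u v j l) (hij : G.Adj (v i) (v j)) :
    ∃ (a b : V) (w : G.Walk a b), IsAlt (omEdges u v) w ∧ w.length = 2 * k + 2 * l + 3 := by
  obtain ⟨b, w, hw, hhead, hlen⟩ := hi
  obtain ⟨b', w', hw', hhead', hlen'⟩ := hj
  have h1 := hM.snd_snd_notMem_omEdges i j
  refine ⟨b, b', w.reverse.append (.cons hij w'), ?_, ?_⟩
  · rw [isAlt_iff, SimpleGraph.Walk.edges_append, SimpleGraph.Walk.edges_reverse,
      SimpleGraph.Walk.edges_cons, List.isChain_append, List.isChain_reverse,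
      List.isChain_cons]
    refine ⟨?_, ⟨fun e he => by simp [h1, hhead' e he], hw'⟩, fun e he f hf => ?_⟩
    · exact List.IsChain.imp (fun e f hef => by tauto) hw
    · rw [List.getLast?_reverse] at he
      simp only [List.head?_cons, Option.mem_some_iff] at hf
      subst hf
      simp [h1, hhead e he]
  · simp only [SimpleGraph.Walk.length_append, SimpleGraph.Walk.length_reverse,
      SimpleGraph.Walk.length_cons, hlen, hlen']
    omega

open Classical in
lemma IsOrderedMatching.exists_isPotential_of_ellM_le (hM : IsOrderedMatching G u v)
    (hs : Function.Surjective (Sum.elim u v)) {n : ℕ} (hn : ellM G (omEdges u v) ≤ 2 * n) :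
    ∃ a, IsPotential G u v n a := by
  have hbd : ∀ {a b : V} (w : G.Walk a b), IsAlt (omEdges u v) w → w.length ≤ 2 * n :=
    fun w hw => (le_csSup (hM.bddAbove_length hs) ⟨_, _, w, hw, rfl⟩).trans hn
  have hlt : ∀ {i k}, HasAltWalk G u v i k → k + 1 ≤ n := by
    rintro i k ⟨b, w, hw, -, hlen⟩
    have := hbd w hw
    omega
  let p : Fin t → ℕ := fun i => Nat.findGreatest (HasAltWalk G u v i) n
  have hp : ∀ i, HasAltWalk G u v i (p i) := fun i =>
    Nat.findGreatest_spec (Nat.zero_le n) (hM.1.hasAltWalk_zero i)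
  have hple : ∀ {i k}, HasAltWalk G u v i k → k ≤ p i := fun h =>
    Nat.le_findGreatest (by have := hlt h; omega) h
  choose f hf using exists_eq_or_eq hs
  let a : V → ℕ := fun x => if x = u (f x) then p (f x) else n - 1 - p (f x)
  have hau : ∀ i, a (u i) = p i := fun i => by
    have : f (u i) = i := by
      rcases hf (u i) with h | h
      exacts [(hM.1.fst_injective h).symm, absurd h (hM.1.fst_ne_snd _ _)]
    simp only [a, this, if_true]
  have hav : ∀ i, a (v i) = n - 1 - p i := fun i => by
    have : f (v i) = i := by
      rcases hf (v i) with h | h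
      exacts [absurd h.symm (hM.1.fst_ne_snd _ _), (hM.1.snd_injective h).symm]
    simp only [a, this, if_neg (hM.1.fst_ne_snd i i).symm]
  refine ⟨a, fun i => ?_, fun x y hxy he => ?_⟩
  · have := hlt (hp i)
    rw [hau, hav]; omega
  · have key : ∀ i j, G.Adj (u i) (v j) → s(u i, v j) ∉ omEdges u v →
        n ≤ a (u i) + a (v j) := fun i j hij hne => by
      rw [hM.1.mk_mem_omEdges_iff] at hne
      have h1 := hple ((hp j).succ hM.1 hij hne)
      rw [hau, hav]
      omega
    obtain ⟨i, rfl | rfl⟩ := exists_eq_or_eq hs x <;> obtain ⟨j, rfl | rfl⟩ := exists_eq_or_eq hs y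
    · exact absurd hxy (hM.2.1 i j)
    · exact key i j hxy he
    · rw [add_comm (a _)]
      exact key j i hxy.symm (by rwa [Sym2.eq_swap])
    · obtain ⟨_, _, w, hw, hlen⟩ := (hp i).exists_walk hM.1 (hp j) hxy
      have := hbd w hw
      rw [hav, hav]; omega

open Koszul in
lemma IsPotential.cert (hM : IsMatchingPair G u v) (hs : Function.Surjective (Sum.elim u v))
    {n : ℕ} {a : V → ℕ} (h : IsPotential G u v n a) : Cert G n := by
  have htight : ∀ x y, G.Adj x y → a x + a y + 1 = n → s(x, y) ∈ omEdges u v := fun x y hxy hn => by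
    by_contra he
    have := h.2 x y hxy he
    omega
  refine ⟨a, fun x y hxy => ?_, fun x => ?_⟩
  · by_cases he : s(x, y) ∈ omEdges u v
    · exact (h.add_eq he).ge
    · exact (h.2 x y hxy he).trans (Nat.le_succ _)
  · obtain ⟨i, rfl | rfl⟩ := exists_eq_or_eq hs x
    · refine ⟨v i, ⟨hM.2 i, h.1 i⟩, fun y hy => ?_⟩
      obtain ⟨j, hj⟩ := htight _ _ hy.1 hy.2
      rcases Sym2.eq_iff.1 hj with ⟨h1, h2⟩ | ⟨h1, -⟩
      · rw [h2, hM.fst_injective h1]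
      · exact absurd h1 (hM.fst_ne_snd _ _)
    · refine ⟨u i, ⟨(hM.2 i).symm, by rw [add_comm (a _)]; exact h.1 i⟩, fun y hy => ?_⟩
      obtain ⟨j, hj⟩ := htight _ _ hy.1 hy.2
      rcases Sym2.eq_iff.1 hj with ⟨h1, -⟩ | ⟨h1, h2⟩
      · exact absurd h1.symm (hM.fst_ne_snd _ _)
      · rw [h2, hM.snd_injective h1]

open Koszul in
lemma IsOrderedMatching.exists_isPotential_of_cert (hM : IsOrderedMatching G u v)
    (hs : Function.Surjective (Sum.elim u v)) {n : ℕ} (h : Cert G n) :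
    ∃ a, IsPotential G u v n a := by
  obtain ⟨a, hge, hex⟩ := h
  have hmate : ∀ k (i : Fin t), t - i ≤ k → a (u i) + a (v i) + 1 = n := by
    intro k
    induction k with
    | zero => intro i hi; omega
    | succ k ih =>
      intro i hi
      obtain ⟨y, ⟨hy, hyn⟩, -⟩ := hex (u i)
      obtain ⟨j, rfl | rfl⟩ := exists_eq_or_eq hs y
      · exact absurd hy (hM.2.1 i j)
      · rcases (hM.2.2 i j hy).eq_or_lt with rfl | hlt
        · exact hyn
        · have hlt' : (i : ℕ) < j := hlt
          have h1 := ih j (by omega)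
          have h2 := (hex (v j)).unique (y₁ := u i) (y₂ := u j) ⟨hy.symm, by omega⟩
            ⟨(hM.1.2 j).symm, by omega⟩
          exact absurd (hM.1.fst_injective h2) hlt.ne
  have htight : ∀ i, a (u i) + a (v i) + 1 = n := fun i => hmate t i (Nat.sub_le _ _)
  refine ⟨a, htight, fun x y hxy he => ?_⟩
  by_contra! hlt
  have hxyn : a x + a y + 1 = n := by
    have := hge x y hxy
    omega
  obtain ⟨i, rfl | rfl⟩ := exists_eq_or_eq hs x
  · have := (hex (u i)).unique (y₁ := y) (y₂ := v i) ⟨hxy, hxyn⟩ ⟨hM.1.2 i, htight i⟩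
    exact he ⟨i, by rw [this]⟩
  · have := (hex (v i)).unique (y₁ := y) (y₂ := u i) ⟨hxy, hxyn⟩
      ⟨(hM.1.2 i).symm, by rw [add_comm (a _)]; exact htight i⟩
    exact he ⟨i, by rw [this, Sym2.eq_swap]⟩

lemma IsMatchingPair.two_mul_le_card [Fintype V] (hM : IsMatchingPair G u v) :
    2 * t ≤ Fintype.card V := by
  have := Fintype.card_le_of_injective _ hM.1
  rw [Fintype.card_sum, Fintype.card_fin] at this
  omega

lemma IsMatchingPair.surjective_iff [Fintype V] (hM : IsMatchingPair G u v) :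
    Function.Surjective (Sum.elim u v) ↔ 2 * t = Fintype.card V := by
  have h : Fintype.card (Fin t ⊕ Fin t) = 2 * t := by
    rw [Fintype.card_sum, Fintype.card_fin, two_mul]
  rw [← h]
  exact ⟨fun hs => Fintype.card_of_bijective ⟨hM.1, hs⟩,
    fun hc => ((Fintype.bijective_iff_injective_and_card _).2 ⟨hM.1, hc⟩).2⟩

lemma IsOrderedMatching.nu0_eq [Fintype V] (hM : IsOrderedMatching G u v)
    (hs : Function.Surjective (Sum.elim u v)) : nu0 G = t := by
  refine IsGreatest.csSup_eq ⟨⟨u, v, hM⟩, ?_⟩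
  rintro s ⟨u', v', hM'⟩
  have := hM'.1.two_mul_le_card
  have := hM.1.surjective_iff.1 hs
  omega

end Matchings

section Stability

open Koszul

variable {V : Type*} [LinearOrder V] [Fintype V] {G : SimpleGraph V}

lemma depthQ_symbPow_eq_iff (K : Type*) [Field K] {t : ℕ} {u v : Fin t → V} (ht : 1 ≤ t)
    (hE : G.edgeSet.Nonempty) (hM : IsOrderedMatching G u v)
    (hs : Function.Surjective (Sum.elim u v)) {n : ℕ} (hn : 1 ≤ n) :
    depthQ K (symbPow K G n) = t - 1 ↔ Cert G n := by
  have hcard := hM.1.surjective_iff.1 hs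
  have : Nonempty V := ⟨u ⟨0, ht⟩⟩
  obtain ⟨hlow, hup⟩ := depthQ_spec (symbPow_le (K := K) hE hn)
  constructor
  · intro h
    by_contra hc
    have := hlow t fun i hi => van_quotient (by omega) fun _ => hc
    omega
  · intro hc
    refine le_antisymm ?_ (hlow _ fun i hi => van_quotient (by omega) fun _ => by omega)
    by_contra! hlt
    obtain ⟨a, ha⟩ := hM.exists_isPotential_of_cert hs hc
    have h1 : Van (MvPolynomial.X : V → MvPolynomial V K) (symbPow K G n) (t - 1 + 1) := by
      refine Van.sub_of_quotient _ (φ := (symbPow K G n).subtype) (ψ := (symbPow K G n).mkQ)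
        (Submodule.subtype_injective _) (Submodule.mkQ_surjective _) ?_ (fun f hf => ?_)
        (hup _ hlt)
      · rw [LinearMap.exact_iff, Submodule.ker_mkQ, Submodule.range_subtype]
      · refine van_mvPolynomial (by omega) _ fun σ hσ => ?_
        rw [kd_comp, hf σ hσ, map_zero]
    rw [Nat.sub_add_cancel ht] at h1
    refine not_van_symbPow ⟨hM.1.1, hs⟩ (Finsupp.equivFunOnFinite.symm a) hM.1.2 ha.1
      (fun x y hxy => ?_) h1
    by_cases he : s(x, y) ∈ omEdges u v
    · obtain ⟨i, hi⟩ := he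
      exact Or.inr ⟨i, Sym2.eq_iff.1 hi⟩
    · exact Or.inl (ha.2 x y hxy he)

end Stability

end DS

/-- If `G` has a perfect ordered matching, then `sdst(J(G)) = (ℓ(G) + 1)/2`, i.e.
`2 · sdst(J(G)) = ℓ(G) + 1`. -/
theorem stmt_11 (K : Type*) [Field K] {r : ℕ} (G : SimpleGraph (Fin r))
    (hE : G.edgeSet.Nonempty)
    (h : ∃ (t : ℕ) (u v : Fin t → Fin r), DS.IsOrderedMatching G u v ∧
      Function.Surjective (Sum.elim u v)) :
    2 * DS.sdst K G = DS.ellG G + 1 := by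
  obtain ⟨t, u, v, hM, hs⟩ := h
  have hnu := hM.nu0_eq hs
  have hcard := hM.1.surjective_iff.1 hs
  have ht : 1 ≤ t := by
    obtain ⟨e, he⟩ := hE
    induction e using Sym2.ind with
    | _ x y =>
      obtain ⟨i, -⟩ := DS.exists_eq_or_eq hs x
      exact i.pos
  subst hnu
  obtain ⟨u', v', hM', hell⟩ := Nat.sInf_mem (s := {n | ∃ u v : Fin (DS.nu0 G) → Fin r,
    DS.IsOrderedMatching G u v ∧ DS.ellM G (DS.omEdges u v) = n}) ⟨_, u, v, hM, rfl⟩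
  change _ = DS.ellG G at hell
  have hs' := hM'.1.surjective_iff.2 hcard
  have h1 : ∀ n, Koszul.Cert G n → 1 ≤ n → DS.ellG G + 1 ≤ 2 * n := fun n hn hn1 => by
    obtain ⟨a, ha⟩ := hM'.exists_isPotential_of_cert hs' hn
    rw [← hell]
    exact ha.ellM_lt hs' hn1
  have h2 : ∀ n, DS.ellG G ≤ 2 * n → Koszul.Cert G n := fun n hn => by
    obtain ⟨a, ha⟩ := hM'.exists_isPotential_of_ellM_le hs' (hell.trans_le hn)
    exact ha.cert hM'.1 hs'
  have : Nonempty (Fin r) := ⟨u ⟨0, ht⟩⟩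
  have hodd : DS.ellG G % 2 = 1 := by
    by_contra hodd
    have h3 := h2 (DS.ellG G / 2) (by omega)
    have h4 : DS.ellG G / 2 ≠ 0 := fun h0 => Koszul.not_cert_zero (h0 ▸ h3)
    have := h1 _ h3 (by omega)
    omega
  have hdepth : ∀ n, 1 ≤ n → (DS.depthQ K (DS.symbPow K G n) =
      Fintype.card (Fin r) - DS.nu0 G - 1 ↔ DS.ellG G + 1 ≤ 2 * n) := fun n hn => by
    rw [← hcard, two_mul, Nat.add_sub_cancel, DS.depthQ_symbPow_eq_iff K ht hE hM hs hn]
    exact ⟨fun h => h1 n h hn, fun h => h2 n (by omega)⟩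
  have hsdst : DS.sdst K G = (DS.ellG G + 1) / 2 := by
    refine IsLeast.csInf_eq ⟨⟨by omega, fun n hn => (hdepth n (by omega)).2 (by omega)⟩, ?_⟩
    rintro n ⟨hn, hall⟩
    have := (hdepth n hn).1 (hall n le_rfl)
    omega
  omega
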